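/- Let k ≥ 5 be odd, set t = ⌊(k-1)/2⌋, and let F be a graph with p(F) ≥ t+1. Then there exists N = N(k,F) such that for all n ≥ N, the maximum number of edges in an n-vertex 2-connected graph that is simultaneously 𝓒_{≥k}-free and F-free equals ex(t,𝓗) + t(n - t), where 𝓗 = {F[S] : S is a vertex covering of F}. -/

import Mathlib

open SimpleGraph

section Defs

variable {V α β : Type*}

/-- `G` contains a copy of `F` as a (not necessarily induced) subgraph. -/
def ContainsCopy (F : SimpleGraph α) (G : SimpleGraph β) : Prop :=
  ∃ f : α → β, Function.Injective f ∧ ∀ ⦃a b⦄, F.Adj a b → G.Adj (f a) (f b)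

/-- The number of edges of `G`. -/
noncomputable def edgeCount (G : SimpleGraph V) : ℕ := G.edgeSet.ncard

/-- `G` has a cycle of length at least `k`, i.e. `G` is not `𝓒_{≥k}`-free. -/
def HasCycleGE (G : SimpleGraph V) (k : ℕ) : Prop :=
  ∃ (v : V) (w : G.Walk v v), w.IsCycle ∧ k ≤ w.length

/-- `G` is 2-connected: it has at least 3 vertices, is connected, and stays
connected after deleting any single vertex. -/
def TwoConnected [Fintype V] (G : SimpleGraph V) : Prop :=
  3 ≤ Fintype.card V ∧ G.Connected ∧ ∀ v : V, (G.induce ({v}ᶜ : Set V)).Connected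

/-- `p(F) ≥ s`: for every proper 2-coloring of `F` both color classes have size
at least `s` (vacuously true for nonbipartite `F`, where `p(F) = ∞`). -/
def PGE [Fintype α] (F : SimpleGraph α) (s : ℕ) : Prop :=
  ∀ c : α → Bool, (∀ a b, F.Adj a b → c a ≠ c b) →
    s ≤ {a | c a = true}.ncard ∧ s ≤ {a | c a = false}.ncard

/-- `S` is a vertex covering of `F`: the complement of `S` is independent. -/
def IsVertexCovering (F : SimpleGraph α) (S : Set α) : Prop :=
  ∀ a b, a ∉ S → b ∉ S → ¬ F.Adj a b

/-- `G` is `𝓗`-free, where `𝓗 = {F[S] : S is a vertex covering of F}`. -/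
def CoverFree (F : SimpleGraph α) (G : SimpleGraph β) : Prop :=
  ∀ S : Set α, IsVertexCovering F S → ¬ ContainsCopy (F.induce S) G

/-- The maximum number of edges of an `n`-vertex graph satisfying `P`
(a generic Turán-type extremal number). -/
noncomputable def exMax (n : ℕ) (P : SimpleGraph (Fin n) → Prop) : ℕ :=
  sSup {m | ∃ G : SimpleGraph (Fin n), P G ∧ edgeCount G = m}

/-- The number of edges of `G` with both endpoints in `T`, i.e. `e(G[T])`. -/
noncomputable def edgesWithin (G : SimpleGraph V) (T : Set V) : ℕ :=
  {e ∈ G.edgeSet | ∀ x ∈ e, x ∈ T}.ncard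

/-- The number of edges of `G` with both endpoints outside `T`, i.e. `e(G−T)`. -/
noncomputable def edgesOutside (G : SimpleGraph V) (T : Set V) : ℕ :=
  {e ∈ G.edgeSet | ∀ x ∈ e, x ∉ T}.ncard

/-- The number of edges of `G` with exactly one endpoint in `T`, i.e. `e(G−T, T)`. -/
noncomputable def edgesCross (G : SimpleGraph V) (T : Set V) : ℕ :=
  {e ∈ G.edgeSet | ∃ a b, e = s(a, b) ∧ a ∈ T ∧ b ∉ T}.ncard

/-- The number of neighbors of `u` lying in `T` (e.g. `d_C(u)` for `T = V(C)`). -/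
noncomputable def degOn (G : SimpleGraph V) (T : Set V) (u : V) : ℕ :=
  {x ∈ T | G.Adj u x}.ncard

/-- The join `T ∨ I_b` of a graph `T` on `Fin a` with an independent set of
`b` vertices. -/
def joinIndep (a b : ℕ) (T : SimpleGraph (Fin a)) : SimpleGraph (Fin a ⊕ Fin b) :=
  SimpleGraph.fromRel (fun x y =>
    x.isLeft ≠ y.isLeft ∨ ∃ u v, x = Sum.inl u ∧ y = Sum.inl v ∧ T.Adj u v)

end Defs

section Part1
open Finset
open scoped Classical

variable {V : Type}

/-- A list whose vertices form a path. -/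
def NPath (G : SimpleGraph V) (l : List V) : Prop := l.IsChain G.Adj ∧ l.Nodup

lemma npath_append {G : SimpleGraph V} {l m : List V} :
    NPath G (l ++ m) ↔ NPath G l ∧ NPath G m ∧ (∀ x ∈ l, x ∉ m) ∧
      (∀ x ∈ l.getLast?, ∀ y ∈ m.head?, G.Adj x y) := by
  unfold NPath
  rw [List.isChain_append, List.nodup_append]
  constructor
  · rintro ⟨⟨a, b, c⟩, d, e, f⟩
    exact ⟨⟨a, d⟩, ⟨b, e⟩, fun x hx hm => f x hx x hm rfl, c⟩
  · rintro ⟨⟨a, d⟩, ⟨b, e⟩, f, c⟩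
    exact ⟨⟨a, b, c⟩, d, e, fun x hx y hy h => f x hx (h ▸ hy)⟩

lemma npath_cons {G : SimpleGraph V} {a : V} {m : List V} :
    NPath G (a :: m) ↔ NPath G m ∧ a ∉ m ∧ (∀ y ∈ m.head?, G.Adj a y) := by
  unfold NPath
  rw [List.isChain_cons, List.nodup_cons]
  tauto

lemma npath_reverse {G : SimpleGraph V} {m : List V} :
    NPath G m.reverse ↔ NPath G m := by
  unfold NPath
  rw [List.isChain_reverse, List.nodup_reverse]
  simp [G.adj_comm]

lemma npath_nil {G : SimpleGraph V} : NPath G [] := by simp [NPath]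

lemma npath_singleton {G : SimpleGraph V} (a : V) : NPath G [a] := by simp [NPath]

lemma hasCycle_of_list {G : SimpleGraph V} {l : List V} (hp : NPath G l) (h3 : 3 ≤ l.length)
    (hcl : ∀ h ∈ l.head?, ∀ e ∈ l.getLast?, G.Adj e h) {k : ℕ} (hk : k ≤ l.length) :
    HasCycleGE G k := by
  obtain ⟨hc, hn⟩ := hp
  match l, hc, hn, h3, hcl, hk with
  | u :: v :: x :: l', hc, hn, h3, hcl, hk =>
    set p := Walk.ofSupport (u :: v :: x :: l') (by simp) hc with hpdef
    have hadj : G.Adj ((u :: v :: x :: l').getLast (by simp)) ((u :: v :: x :: l').head (by simp)) :=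
      hcl _ (by simp) _ (by simp [List.getLast?_eq_some_getLast])
    refine ⟨_, Walk.cons hadj p, ?_, ?_⟩
    · rw [Walk.cons_isCycle_iff]
      refine ⟨?_, ?_⟩
      · rw [Walk.isPath_def, hpdef, Walk.support_ofSupport]; exact hn
      · intro hmem
        have hpe : p = Walk.cons hc.rel (Walk.ofSupport (v :: x :: l') (by simp) hc.of_cons) := rfl
        rw [hpe] at hmem
        have hmem' := List.mem_cons.1 ((Walk.edges_cons _ _) ▸ hmem)
        rcases hmem' with h | h
        · have h2 : (u :: v :: x :: l').getLast (by simp) = v := by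
            have hne := hadj.ne
            rw [Sym2.eq_iff] at h
            rcases h with ⟨a, b⟩ | ⟨a, b⟩
            · exact absurd a hne
            · exact a
          have h3 : v ∈ x :: l' := by
            rw [← h2]; simp
          have := (List.nodup_cons.1 (List.nodup_cons.1 hn).2).1
          exact this h3
        · have := Walk.snd_mem_support_of_mem_edges _ h
          have hs : (Walk.ofSupport (v :: x :: l') (by simp) hc.of_cons).support = v :: x :: l' :=
            Walk.support_ofSupport _ _
          have this2 : u ∈ (Walk.ofSupport (v :: x :: l') (by simp) hc.of_cons).support := this
          rw [hs] at this2
          exact (List.nodup_cons.1 hn).1 this2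
    · have : p.support.length = p.length + 1 := Walk.length_support p
      rw [hpdef, Walk.support_ofSupport] at this
      simp only [Walk.length_cons]
      rw [← hpdef] at this
      omega

/-- Connectivity of the subgraph induced on `D`, in the language of cuts. -/
def Conn (G : SimpleGraph V) (D : Finset V) : Prop :=
  ∀ K ⊆ D, K.Nonempty → (∀ u ∈ K, ∀ w ∈ D, G.Adj u w → w ∈ K) → K = D

lemma exists_path_to {G : SimpleGraph V} {U : Finset V} (hU : Conn G U) {T : Finset V} (hT : T.Nonempty)
    (hTU : T ⊆ U) {u : V} (hu : u ∈ U) :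
    ∃ q : List V, ∃ z ∈ T, NPath G (q ++ [z]) ∧ (∀ x ∈ q ++ [z], x ∈ U) ∧ (∀ x ∈ q, x ∉ T) ∧
      (q ++ [z]).head? = some u := by
  let P : V → Prop := fun u => ∃ q : List V, ∃ z ∈ T, NPath G (q ++ [z]) ∧ (∀ x ∈ q ++ [z], x ∈ U) ∧ (∀ x ∈ q, x ∉ T) ∧
      (q ++ [z]).head? = some u
  have hT' : ∀ z ∈ T, P z := fun z hz =>
    ⟨[], z, hz, npath_singleton z, by simpa using hTU hz, by simp, by simp⟩
  have key : U.filter P = U := by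
    apply hU _ (filter_subset _ _)
    · obtain ⟨z, hz⟩ := hT
      exact ⟨z, mem_filter.2 ⟨hTU hz, hT' z hz⟩⟩
    · intro v hv w hw hvw
      rw [mem_filter] at hv ⊢
      refine ⟨hw, ?_⟩
      obtain ⟨hvU, q, z, hz, hp, hin, hout, hh⟩ := hv
      by_cases hwT : w ∈ T
      · exact hT' w hwT
      by_cases hwq : w ∈ q
      · obtain ⟨l1, l2, rfl⟩ := List.append_of_mem hwq
        refine ⟨w :: l2, z, hz, ?_, ?_, ?_, by simp⟩
        · rw [List.append_assoc] at hp
          exact (npath_append.1 hp).2.1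
        · intro x hx; apply hin; simp at hx ⊢; tauto
        · intro x hx; apply hout; simp at hx ⊢; tauto
      · refine ⟨w :: q, z, hz, ?_, ?_, ?_, by simp⟩
        · rw [List.cons_append, npath_cons]
          refine ⟨hp, ?_, ?_⟩
          · simp only [List.mem_append, List.mem_singleton]
            rintro (h | h)
            · exact hwq h
            · exact hwT (h ▸ hz)
          · rw [hh]; intro y hy; simp at hy; subst hy; exact hvw.symm
        · intro x hx
          simp only [List.cons_append, List.mem_cons] at hx
          rcases hx with rfl | hx
          · exact hw
          · exact hin x hx
        · intro x hx
          simp only [List.mem_cons] at hx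
          rcases hx with rfl | hx
          · exact hwT
          · exact hout x hx
  rw [← key] at hu
  exact (mem_filter.1 hu).2

lemma exists_path {G : SimpleGraph V} {U : Finset V} (hU : Conn G U) {u v : V} (hu : u ∈ U) (hv : v ∈ U) :
    ∃ l : List V, NPath G l ∧ (∀ x ∈ l, x ∈ U) ∧ l.head? = some u ∧ l.getLast? = some v := by
  obtain ⟨q, z, hz, h1, h2, h3, h4⟩ := exists_path_to hU (T := {v}) (by simp) (by simpa using hv) hu
  rw [mem_singleton] at hz
  subst hz
  exact ⟨q ++ [z], h1, h2, h4, by simp⟩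

/-- Connected components inside `U`, as a finset of finsets. -/
noncomputable def comps (G : SimpleGraph V) (U : Finset V) : Finset (Finset V) :=
  U.powerset.filter (fun K => K.Nonempty ∧ Conn G K ∧ ∀ u ∈ K, ∀ w ∈ U, G.Adj u w → w ∈ K)

lemma mem_comps {G : SimpleGraph V} {U K : Finset V} :
    K ∈ comps G U ↔ K ⊆ U ∧ K.Nonempty ∧ Conn G K ∧ ∀ u ∈ K, ∀ w ∈ U, G.Adj u w → w ∈ K := by
  simp [comps]

/-- A minimal nonempty set with a property inherited by closed pieces is connected. -/
lemma conn_of_minimal {G : SimpleGraph V} {K : Finset V}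
    (h : ∀ K1 ⊂ K, K1.Nonempty → (∀ u ∈ K1, ∀ w ∈ K, G.Adj u w → w ∈ K1) → False) : Conn G K := by
  intro K1 hK1 hne hcl
  by_contra hne'
  exact h K1 (hK1.ssubset_of_ne hne') hne hcl

lemma exists_comp {G : SimpleGraph V} {U : Finset V} {u : V} (hu : u ∈ U) :
    ∃ K ∈ comps G U, u ∈ K := by
  let S := U.powerset.filter (fun K => u ∈ K ∧ ∀ x ∈ K, ∀ w ∈ U, G.Adj x w → w ∈ K)
  have hS : S.Nonempty := ⟨U, by simp only [S, mem_filter, mem_powerset]; exact ⟨subset_rfl, hu, fun x _ w hw _ => hw⟩⟩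
  obtain ⟨K, hK, hmin⟩ := S.exists_min_image card hS
  simp only [S, mem_filter, mem_powerset] at hK hmin
  obtain ⟨hKU, huK, hcl⟩ := hK
  refine ⟨K, mem_comps.2 ⟨hKU, ⟨u, huK⟩, ?_, hcl⟩, huK⟩
  apply conn_of_minimal
  intro K1 hK1 hne hcl1
  have hcl' : ∀ x ∈ K1, ∀ w ∈ U, G.Adj x w → w ∈ K1 := fun x hx w hw hxw =>
    hcl1 x hx w (hcl x (hK1.1 hx) w hw hxw) hxw
  by_cases hu1 : u ∈ K1
  · have := hmin K1 ⟨hK1.1.trans hKU, hu1, hcl'⟩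
    exact absurd (card_lt_card hK1) (by omega)
  · have := hmin (K \ K1) ⟨sdiff_subset.trans hKU, by simp [huK, hu1], ?_⟩
    · obtain ⟨y, hy⟩ := hne
      have : K \ K1 ⊂ K := by
        refine ⟨sdiff_subset, fun h => ?_⟩
        have := h (hK1.1 hy)
        simp [hy] at this
      exact absurd (card_lt_card this) (by omega)
    · intro x hx w hw hxw
      rw [mem_sdiff] at hx ⊢
      exact ⟨hcl x hx.1 w hw hxw, fun h => hx.2 (hcl1 w h x hx.1 hxw.symm)⟩

lemma comps_disjoint {G : SimpleGraph V} {U K1 K2 : Finset V} (h1 : K1 ∈ comps G U) (h2 : K2 ∈ comps G U)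
    (hne : K1 ≠ K2) : Disjoint K1 K2 := by
  rw [mem_comps] at h1 h2
  by_contra h
  rw [disjoint_iff_inter_eq_empty, ← ne_eq, ← nonempty_iff_ne_empty] at h
  have hcl : ∀ u ∈ K1 ∩ K2, ∀ w ∈ U, G.Adj u w → w ∈ K1 ∩ K2 := by
    intro u hu w hw huw
    rw [mem_inter] at hu ⊢
    exact ⟨h1.2.2.2 u hu.1 w hw huw, h2.2.2.2 u hu.2 w hw huw⟩
  have e1 := h1.2.2.1 (K1 ∩ K2) inter_subset_left h (fun u hu w hw => hcl u hu w (h1.1 hw))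
  have e2 := h2.2.2.1 (K1 ∩ K2) inter_subset_right h (fun u hu w hw => hcl u hu w (h2.1 hw))
  exact hne (e1.symm.trans e2)

/-- 2-connectivity of the subgraph induced on `W`, in the language of cuts. -/
def TwoC (G : SimpleGraph V) (W : Finset V) : Prop :=
  3 ≤ #W ∧ ∀ X : Finset V, #X ≤ 1 → Conn G (W \ X)

lemma TwoC.conn {G : SimpleGraph V} {W : Finset V} (h : TwoC G W) : Conn G W := by
  simpa using h.2 ∅ (by simp)

lemma TwoC.conn_erase {G : SimpleGraph V} {W : Finset V} (h : TwoC G W) (v : V) : Conn G (W.erase v) := by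
  have := h.2 {v} (by simp)
  rwa [sdiff_singleton_eq_erase] at this

end Part1

section Part2
open Finset
open scoped Classical

variable {V : Type}

/-- Number of ordered adjacent pairs in `X × Y`. -/
noncomputable def IE (G : SimpleGraph V) (X Y : Finset V) : ℕ :=
  ∑ x ∈ X, ∑ y ∈ Y, if G.Adj x y then 1 else 0

lemma IE_eq (G : SimpleGraph V) (X Y : Finset V) : IE G X Y = ∑ x ∈ X, #(Y.filter (G.Adj x)) := by
  simp only [IE, card_filter]

lemma IE_comm (G : SimpleGraph V) (X Y : Finset V) : IE G X Y = IE G Y X := by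
  unfold IE; rw [sum_comm]; simp [G.adj_comm]

lemma IE_union_left (G : SimpleGraph V) {X X' : Finset V} (h : Disjoint X X') (Y : Finset V) :
    IE G (X ∪ X') Y = IE G X Y + IE G X' Y := by
  unfold IE; rw [sum_union h]

lemma IE_union_right (G : SimpleGraph V) {Y Y' : Finset V} (h : Disjoint Y Y') (X : Finset V) :
    IE G X (Y ∪ Y') = IE G X Y + IE G X Y' := by
  rw [IE_comm, IE_union_left G h, IE_comm G Y, IE_comm G Y']

lemma IE_singleton_left (G : SimpleGraph V) (x : V) (Y : Finset V) :
    IE G {x} Y = #(Y.filter (G.Adj x)) := by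
  simp [IE_eq]

lemma IE_singleton_right (G : SimpleGraph V) (x : V) (Y : Finset V) :
    IE G Y {x} = #(Y.filter (G.Adj x)) := by
  rw [IE_comm, IE_singleton_left]

lemma IE_eq_zero (G : SimpleGraph V) {X Y : Finset V} (h : ∀ x ∈ X, ∀ y ∈ Y, ¬ G.Adj x y) :
    IE G X Y = 0 := by
  unfold IE
  exact sum_eq_zero fun x hx => sum_eq_zero fun y hy => by simp [h x hx y hy]

lemma IE_le_mul (G : SimpleGraph V) (X Y : Finset V) : IE G X Y ≤ #X * #Y := by
  rw [IE_eq]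
  calc _ ≤ ∑ x ∈ X, #Y := sum_le_sum fun x _ => card_filter_le _ _
    _ = _ := by simp

lemma IE_union_self (G : SimpleGraph V) {X X' : Finset V} (h : Disjoint X X') :
    IE G (X ∪ X') (X ∪ X') = IE G X X + IE G X' X' + 2 * IE G X X' := by
  rw [IE_union_left G h, IE_union_right G h, IE_union_right G h, IE_comm G X' X]; ring

lemma IE_insert_self (G : SimpleGraph V) {x : V} {X : Finset V} (h : x ∉ X) :
    IE G (insert x X) (insert x X) = IE G X X + 2 * #(X.filter (G.Adj x)) := by
  rw [insert_eq, IE_union_self G (by simpa using h), IE_singleton_left, IE_singleton_left]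
  simp [filter_singleton]

lemma npath_length_le {G : SimpleGraph V} {l : List V} (h : NPath G l) {D : Finset V}
    (hD : ∀ x ∈ l, x ∈ D) : l.length ≤ #D := by
  rw [← List.toFinset_card_of_nodup h.2]
  exact card_le_card fun x hx => hD x (by simpa using hx)

/-- once in a set closed relative to `x,y`, a path avoiding `x,y` stays in it -/
lemma stay_in {G : SimpleGraph V} {K D : Finset V} : ∀ {l : List V} {z : V},
    NPath G (z :: l) → (∀ v ∈ l, v ∈ D) → (∀ u ∈ K, ∀ w ∈ D, G.Adj u w → w ∉ l ∨ w ∈ K) → z ∈ K →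
    ∀ v ∈ l, v ∈ K
  | [], _, _, _, _, _ => by simp
  | w :: l, z, hp, hD, hK, hz => by
    have hzw : G.Adj z w := (npath_cons.1 hp).2.2 w (by simp)
    have hw : w ∈ K := by
      rcases hK z hz w (hD w (by simp)) hzw with h | h
      · simp at h
      · exact h
    intro v hv
    rcases List.mem_cons.1 hv with rfl | hv
    · exact hw
    · refine stay_in (npath_cons.1 hp).1 (fun v hv => hD v (by simp [hv])) ?_ hw v hv
      intro u hu w' hw' ha
      rcases hK u hu w' hw' ha with h | h
      · left; intro h'; exact h (by simp [h'])
      · exact Or.inr h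

/-- contraction of `y` into `x` -/
def contr (G : SimpleGraph V) (x y : V) : SimpleGraph V where
  Adj u w := u ≠ w ∧ (G.Adj u w ∨ (u = x ∧ G.Adj y w) ∨ (w = x ∧ G.Adj u y))
  symm := ⟨by
    rintro u w ⟨h, h1 | ⟨h1, h2⟩ | ⟨h1, h2⟩⟩
    · exact ⟨h.symm, Or.inl h1.symm⟩
    · exact ⟨h.symm, Or.inr (Or.inr ⟨h1, h2.symm⟩)⟩
    · exact ⟨h.symm, Or.inr (Or.inl ⟨h1, h2.symm⟩)⟩⟩
  loopless := ⟨by rintro u ⟨h, _⟩; exact h rfl⟩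

lemma contr_adj {G : SimpleGraph V} {x y u w : V} : (contr G x y).Adj u w ↔
    u ≠ w ∧ (G.Adj u w ∨ (u = x ∧ G.Adj y w) ∨ (w = x ∧ G.Adj u y)) := Iff.rfl

lemma contr_adj_of_ne {G : SimpleGraph V} {x y u w : V} (hu : u ≠ x) (hw : w ≠ x) :
    (contr G x y).Adj u w ↔ G.Adj u w := by
  rw [contr_adj]
  constructor
  · rintro ⟨_, h | h | h⟩
    · exact h
    · exact absurd h.1 hu
    · exact absurd h.1 hw
  · intro h; exact ⟨h.ne, Or.inl h⟩

lemma npath_contr_of_notMem {G : SimpleGraph V} {x y : V} {l : List V} (hl : NPath (contr G x y) l)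
    (hx : x ∉ l) : NPath G l := by
  refine ⟨?_, hl.2⟩
  induction l with
  | nil => simp
  | cons a l ih =>
    rw [npath_cons] at hl
    rw [List.isChain_cons]
    refine ⟨?_, ih hl.1 (by simp at hx; tauto)⟩
    intro b hb
    have hb' : b ∈ l := List.mem_of_mem_head? hb
    exact (contr_adj_of_ne (by rintro rfl; simp at hx) (by rintro rfl; simp [hb'] at hx)).1 (hl.2.2 b hb)

lemma contr_lift {G : SimpleGraph V} {x y : V} (hxy : G.Adj x y) {X Y Y' D : Finset V}
    (hxX : x ∈ X) (hxD : x ∈ D) (hyD : y ∈ D)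
    (hY' : ∀ z ∈ Y', z ∈ Y ∨ (z = x ∧ y ∈ Y)) {l : List V}
    (hl : NPath (contr G x y) l) (hlD : ∀ z ∈ l, z ∈ D.erase y) (hne : l ≠ [])
    (hh : ∀ h ∈ l.head?, h ∈ X.erase y) (he : ∀ e ∈ l.getLast?, e ∈ Y') :
    ∃ l', NPath G l' ∧ (∀ z ∈ l', z ∈ D) ∧ l' ≠ [] ∧ (∀ h ∈ l'.head?, h ∈ X) ∧
      (∀ e ∈ l'.getLast?, e ∈ Y) ∧ l.length ≤ l'.length := by
  have hyl : y ∉ l := fun h => by simpa using hlD y h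
  by_cases hx : x ∈ l
  · obtain ⟨l1, l2, rfl⟩ := List.append_of_mem hx
    rw [npath_append, npath_cons] at hl
    obtain ⟨hl1, ⟨hl2, hx2, hr⟩, hdisj, hle⟩ := hl
    have hx1 : x ∉ l1 := fun h => hdisj x h (by simp)
    have hy1 : y ∉ l1 := fun h => hyl (by simp [h])
    have hy2 : y ∉ l2 := fun h => hyl (by simp [h])
    have g1 := npath_contr_of_notMem hl1 hx1
    have g2 := npath_contr_of_notMem hl2 hx2
    have hL : ∃ z, (z = x ∨ z = y) ∧ (∀ a ∈ l1.getLast?, G.Adj a z) ∧ (l1 = [] → z ∈ X) := by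
      by_cases h1 : l1 = []
      · subst h1; exact ⟨x, Or.inl rfl, by simp, fun _ => hxX⟩
      · obtain ⟨a, ha⟩ : ∃ a, l1.getLast? = some a := ⟨_, List.getLast?_eq_some_getLast h1⟩
        have hal : a ∈ l1 := List.mem_of_mem_getLast? ha
        have := (contr_adj.1 (hle a ha x (by simp))).2
        rcases this with h | h | h
        · exact ⟨x, Or.inl rfl, by rw [ha]; simpa using h, fun h => absurd h h1⟩
        · exact absurd (h.1 ▸ hal) hx1
        · exact ⟨y, Or.inr rfl, by rw [ha]; simpa using h.2, fun h => absurd h h1⟩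
    have hR : ∃ z, (z = x ∨ z = y) ∧ (∀ a ∈ l2.head?, G.Adj z a) ∧ (l2 = [] → z ∈ Y) := by
      by_cases h1 : l2 = []
      · subst h1
        rcases hY' x (he x (by simp)) with h | h
        · exact ⟨x, Or.inl rfl, by simp, fun _ => h⟩
        · exact ⟨y, Or.inr rfl, by simp, fun _ => h.2⟩
      · obtain ⟨a, ha⟩ : ∃ a, l2.head? = some a := ⟨_, List.head?_eq_some_head h1⟩
        have hal : a ∈ l2 := List.mem_of_mem_head? ha
        have := (contr_adj.1 (hr a ha)).2
        rcases this with h | h | h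
        · exact ⟨x, Or.inl rfl, by rw [ha]; simpa using h, fun h => absurd h h1⟩
        · exact ⟨y, Or.inr rfl, by rw [ha]; simpa using h.2, fun h => absurd h h1⟩
        · exact absurd (h.1 ▸ hal) hx2
    obtain ⟨z, hz, hz1, hz2⟩ := hL
    obtain ⟨z', hz', hz'1, hz'2⟩ := hR
    obtain ⟨m, hm, hmne, hmh, hml, hms⟩ : ∃ m : List V, NPath G m ∧ m ≠ [] ∧ m.head? = some z ∧
        m.getLast? = some z' ∧ ∀ w ∈ m, w = x ∨ w = y := by
      by_cases h : z = z'
      · subst h; exact ⟨[z], npath_singleton _, by simp, by simp, by simp, by simpa using hz⟩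
      · refine ⟨[z, z'], ?_, by simp, by simp, by simp, by simp [hz, hz']⟩
        rw [npath_cons]
        refine ⟨npath_singleton _, by simpa using h, ?_⟩
        simp only [List.head?_cons, Option.mem_some_iff, forall_eq']
        rcases hz with rfl | rfl <;> rcases hz' with rfl | rfl
        · exact absurd rfl h
        · exact hxy
        · exact hxy.symm
        · exact absurd rfl h
    have hml1 : ∀ w ∈ m, w ∉ l1 := fun w hw => by
      rcases hms w hw with rfl | rfl
      · exact hx1
      · exact hy1
    have hml2 : ∀ w ∈ m, w ∉ l2 := fun w hw => by
      rcases hms w hw with rfl | rfl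
      · exact hx2
      · exact hy2
    refine ⟨l1 ++ (m ++ l2), ?_, ?_, by simp [hmne], ?_, ?_, ?_⟩
    · rw [npath_append, npath_append]
      refine ⟨g1, ⟨hm, g2, hml2, ?_⟩, ?_, ?_⟩
      · rw [hml]; simpa using hz'1
      · intro w hw
        rw [List.mem_append]
        rintro (h | h)
        · exact hml1 w h hw
        · exact hdisj w hw (by simp [h])
      · rw [List.head?_append, hmh]; simpa using hz1
    · intro w hw
      simp only [List.mem_append] at hw
      rcases hw with h | h | h
      · exact mem_of_mem_erase (hlD w (by simp [h]))
      · rcases hms w h with rfl | rfl <;> assumption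
      · exact mem_of_mem_erase (hlD w (by simp [h]))
    · by_cases h1 : l1 = []
      · subst h1; simp [List.head?_append, hmh]; exact hz2 rfl
      · intro w hw
        have : w ∈ X.erase y := by
          apply hh
          rw [List.head?_append] at hw ⊢
          rw [List.head?_eq_some_head h1] at hw ⊢
          simpa using hw
        exact mem_of_mem_erase this
    · by_cases h1 : l2 = []
      · subst h1; simp [List.getLast?_append, hml]; exact hz'2 rfl
      · intro w hw
        have hw' : w ∈ l2.getLast? := by
          rw [List.getLast?_append, List.getLast?_append, List.getLast?_eq_some_getLast h1] at hw
          rw [List.getLast?_eq_some_getLast h1]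
          simpa using hw
        have : w ∈ Y' := by
          apply he
          rw [List.getLast?_append, List.getLast?_cons]
          rw [Option.mem_def] at hw'
          simp [hw']
        rcases hY' w this with h | h
        · exact h
        · exact absurd (h.1 ▸ List.mem_of_mem_getLast? hw') hx2
    · simp only [List.length_append, List.length_cons]
      have : 0 < m.length := List.length_pos_iff.2 hmne
      omega
  · refine ⟨l, npath_contr_of_notMem hl hx, fun z hz => mem_of_mem_erase (hlD z hz), hne,
      fun h hh' => mem_of_mem_erase (hh h hh'), ?_, le_rfl⟩
    intro e he'
    rcases hY' e (he e he') with h | h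
    · exact h
    · exact absurd (h.1 ▸ List.mem_of_mem_getLast? he') hx

lemma contr_count {G : SimpleGraph V} {x y : V} (hxy : G.Adj x y) {D : Finset V}
    (hxD : x ∈ D) (hyD : y ∈ D) :
    IE G D D = IE (contr G x y) (D.erase y) (D.erase y) +
      2 * (1 + #(D.filter (fun z => G.Adj x z ∧ G.Adj y z))) := by
  set D0 := (D.erase y).erase x with hD0
  have e1 : D.erase y = insert x D0 := by
    rw [hD0, insert_erase]; simp [hxD, hxy.ne]
  have e2 : D = insert y (insert x D0) := by rw [← e1, insert_erase hyD]
  have hx0 : x ∉ D0 := by simp [hD0]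
  have hy0 : y ∉ D0 := by simp [hD0]
  have hy1 : y ∉ insert x D0 := by simp [hy0, hxy.ne.symm]
  have c1 : IE (contr G x y) D0 D0 = IE G D0 D0 := by
    unfold IE
    refine sum_congr rfl fun u hu => sum_congr rfl fun w hw => ?_
    rw [contr_adj_of_ne (by rintro rfl; exact hx0 hu) (by rintro rfl; exact hx0 hw)]
  have c2 : D0.filter ((contr G x y).Adj x) = D0.filter (G.Adj x) ∪ D0.filter (G.Adj y) := by
    rw [← filter_or]
    apply filter_congr
    intro w hw
    rw [contr_adj]
    have : x ≠ w := by rintro rfl; exact hx0 hw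
    constructor
    · rintro ⟨_, h | h | h⟩
      · exact Or.inl h
      · exact Or.inr h.2
      · exact absurd h.1.symm this
    · rintro (h | h)
      · exact ⟨this, Or.inl h⟩
      · exact ⟨this, Or.inr (Or.inl ⟨rfl, h⟩)⟩
  have c3 : D.filter (fun z => G.Adj x z ∧ G.Adj y z) = D0.filter (G.Adj x) ∩ D0.filter (G.Adj y) := by
    rw [← filter_and, e2, filter_insert, filter_insert]
    simp
  have c4 := card_union_add_card_inter (D0.filter (G.Adj x)) (D0.filter (G.Adj y))
  rw [c3, e1, IE_insert_self _ hx0, c1, c2]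
  conv_lhs => rw [e2]
  rw [IE_insert_self _ hy1, IE_insert_self _ hx0, filter_insert, if_pos hxy.symm,
    card_insert_of_notMem (by simp [hx0])]
  omega

end Part2

section Part3
open Finset
open scoped Classical

variable {V : Type}

/-- admissible path from `X` to `Y` inside `D` -/
def XYPath (G : SimpleGraph V) (D X Y : Finset V) (l : List V) : Prop :=
  NPath G l ∧ (∀ z ∈ l, z ∈ D) ∧ l ≠ [] ∧ (∀ h ∈ l.head?, h ∈ X) ∧ (∀ e ∈ l.getLast?, e ∈ Y)

/-- the separation hypothesis for gadgets -/
def Gad (G : SimpleGraph V) (D X Y : Finset V) : Prop :=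
  ∀ v ∈ D, ∀ K ⊆ D.erase v, K.Nonempty → (∀ u ∈ K, ∀ w ∈ D, G.Adj u w → w ∈ K ∨ w = v) →
    ∃ z ∈ K, z ∈ X ∪ Y

lemma exists_longest {P : List V → Prop} {N : ℕ} (hb : ∀ l, P l → l.length ≤ N) {l0 : List V} (h0 : P l0) :
    ∃ l, P l ∧ l0.length ≤ l.length ∧ ∀ l', P l' → l'.length ≤ l.length := by
  let Q : ℕ → Prop := fun n => ∃ l, P l ∧ l.length = n
  have hQ : Q (Nat.findGreatest Q N) := Nat.findGreatest_spec (P := Q) (hb l0 h0) ⟨l0, h0, rfl⟩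
  obtain ⟨l, hl, hlen⟩ := hQ
  have : ∀ l', P l' → l'.length ≤ l.length := fun l' hl' => by
    rw [hlen]; exact Nat.le_findGreatest (hb l' hl') ⟨l', hl', rfl⟩
  exact ⟨l, hl, this l0 h0, this⟩

/-- Gadget path lemma. -/
theorem gadget_path {τ : ℕ} (hτ : 3 ≤ τ) : ∀ (n : ℕ) (G : SimpleGraph V) (D X Y : Finset V), #D = n →
    X ⊆ D → Y ⊆ D → X.Nonempty → Y.Nonempty → Conn G D → Gad G D X Y →
    2 * τ * #D ≤ IE G D D + 2 * #X + 2 * #Y → ∃ l, XYPath G D X Y l ∧ τ ≤ l.length := by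
  intro n
  induction n using Nat.strong_induction_on with
  | _ n ih =>
  intro G D X Y hDn hXD hYD hX hY hconn hgad hcount
  -- two distinct endpoints
  obtain ⟨u, hu, v, hv, huv⟩ : ∃ u ∈ X, ∃ v ∈ Y, u ≠ v := by
    by_contra hcon
    push Not at hcon
    obtain ⟨p, hp⟩ := hX
    have hYp : ∀ y ∈ Y, y = p := fun y hy => (hcon p hp y hy).symm
    obtain ⟨q, hq⟩ := hY
    have hXp : ∀ x ∈ X, x = p := fun x hx => (hcon x hx q hq).trans (hYp q hq)
    have hcX : #X ≤ 1 := card_le_one.2 fun a ha b hb => (hXp a ha).trans (hXp b hb).symm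
    have hcY : #Y ≤ 1 := card_le_one.2 fun a ha b hb => (hYp a ha).trans (hYp b hb).symm
    have hDp : D = {p} := by
      by_contra hne
      have hne' : (D.erase p).Nonempty := by
        rw [nonempty_iff_ne_empty]
        intro h
        rw [erase_eq_empty_iff] at h
        rcases h with h | h
        · rw [h] at hXD; simpa using hXD hp
        · exact hne h
      obtain ⟨z, hz, hzXY⟩ := hgad p (hXD hp) (D.erase p) subset_rfl hne' (by
        intro u _ w hw _
        by_cases h : w = p
        · exact Or.inr h
        · exact Or.inl (mem_erase.2 ⟨h, hw⟩))
      rw [mem_union] at hzXY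
      have : z = p := by rcases hzXY with h | h; exacts [hXp z h, hYp z h]
      simp [this] at hz
    rw [hDp, IE_singleton_left] at hcount
    simp [filter_singleton] at hcount
    omega
  obtain ⟨l0, hl0, hl0D, hl0h, hl0e⟩ := exists_path hconn (hXD hu) (hYD hv)
  have hl0len : 2 ≤ l0.length := by
    match l0, hl0h, hl0e with
    | [a], h1, h2 => simp at h1 h2; exact absurd (h1.symm.trans h2) huv
    | a :: b :: l, _, _ => simp
  have hP0 : XYPath G D X Y l0 := ⟨hl0, hl0D, by rintro rfl; simp at hl0len,
    by rw [hl0h]; simpa using hu, by rw [hl0e]; simpa using hv⟩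
  obtain ⟨l, hl, hlen, hmax⟩ := exists_longest (P := XYPath G D X Y) (N := #D)
    (fun l hl => npath_length_le hl.1 hl.2.1) hP0
  by_contra hcon
  push Not at hcon
  obtain ⟨x, y, l2, rfl⟩ : ∃ x y l2, l = x :: y :: l2 := by
    match l, hlen with
    | [], h => simp only [List.length_nil] at h; omega
    | [a], h => simp only [List.length_cons, List.length_nil] at h; omega
    | a :: b :: l, _ => exact ⟨a, b, l, rfl⟩
  have hltau := hcon _ hl
  obtain ⟨hlp, hlD, -, hlh, hle⟩ := hl
  have hxX : x ∈ X := hlh x (by simp)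
  have hxD : x ∈ D := hXD hxX
  have hyD : y ∈ D := hlD y (by simp)
  obtain ⟨hlp1, hxn, hxy'⟩ := npath_cons.1 hlp
  have hxy : G.Adj x y := hxy' y (by simp)
  obtain ⟨hlp2, hyn, hyl⟩ := npath_cons.1 hlp1
  have hle' : ∀ e ∈ (y :: l2).getLast?, e ∈ Y := by
    intro e he; apply hle; simpa [List.getLast?_cons] using he
  let Bad : Finset V → Prop := fun K => K.Nonempty ∧ x ∉ K ∧ y ∉ K ∧
    (∀ u ∈ K, ∀ w ∈ D, G.Adj u w → w ∈ K ∨ w = x ∨ w = y) ∧ ∀ z ∈ K, z ∉ X ∪ Y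
  by_cases hA : ∃ K ⊆ D, Bad K
  · -- Case A
    obtain ⟨K0, hK0D, hK0⟩ := hA
    obtain ⟨K, hK, hKmin⟩ := (D.powerset.filter Bad).exists_min_image card
      ⟨K0, by simp only [mem_filter, mem_powerset]; exact ⟨hK0D, hK0⟩⟩
    simp only [mem_filter, mem_powerset] at hK hKmin
    obtain ⟨hKD, hKne, hxK, hyK, hKcl, hKmiss⟩ := hK
    have hKconn : Conn G K := by
      apply conn_of_minimal
      intro K1 hK1 hne hcl
      have := hKmin K1 ⟨hK1.1.trans hKD, hne, fun h => hxK (hK1.1 h), fun h => hyK (hK1.1 h), ?_,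
        fun z hz => hKmiss z (hK1.1 hz)⟩
      · exact absurd (card_lt_card hK1) (by omega)
      · intro u hu w hw ha
        rcases hKcl u (hK1.1 hu) w hw ha with h | h
        · exact Or.inl (hcl u hu w h ha)
        · exact Or.inr h
    have hXKne : (K.filter (G.Adj x)).Nonempty := by
      by_contra h
      rw [not_nonempty_iff_eq_empty, filter_eq_empty_iff] at h
      obtain ⟨z, hz, hz'⟩ := hgad y hyD K (fun z hz => mem_erase.2 ⟨by rintro rfl; exact hyK hz, hKD hz⟩) hKne (by
        intro u hu w hw ha
        rcases hKcl u hu w hw ha with h' | rfl | h'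
        · exact Or.inl h'
        · exact absurd ha.symm (h hu)
        · exact Or.inr h')
      exact hKmiss z hz hz'
    have hYKne : (K.filter (G.Adj y)).Nonempty := by
      by_contra h
      rw [not_nonempty_iff_eq_empty, filter_eq_empty_iff] at h
      obtain ⟨z, hz, hz'⟩ := hgad x hxD K (fun z hz => mem_erase.2 ⟨by rintro rfl; exact hxK hz, hKD hz⟩) hKne (by
        intro u hu w hw ha
        rcases hKcl u hu w hw ha with h' | h' | rfl
        · exact Or.inl h'
        · exact Or.inr h'
        · exact absurd ha.symm (h hu))
      exact hKmiss z hz hz'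
    have hKlt : #K < #D := card_lt_card ⟨hKD, fun h => hxK (h hxD)⟩
    by_cases hcK : 2 * τ * #K ≤ IE G K K + 2 * #(K.filter (G.Adj x)) + 2 * #(K.filter (G.Adj y))
    · obtain ⟨lK, ⟨hk1, hk2, hk3, hk4, hk5⟩, hk6⟩ := ih _ (hDn ▸ hKlt) G K _ _ rfl (filter_subset _ _)
        (filter_subset _ _) hXKne hYKne hKconn (by
          intro v hv K1 hK1 hne hcl
          by_contra hno
          push Not at hno
          have hK1K : K1 ⊆ K := hK1.trans (erase_subset _ _)
          obtain ⟨z, hz, hz'⟩ := hgad v (hKD hv) K1 (fun z hz => mem_erase.2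
            ⟨(mem_erase.1 (hK1 hz)).1, hKD (hK1K hz)⟩) hne (by
              intro u hu w hw ha
              have huno := hno u hu
              simp only [mem_union, mem_filter, not_or, not_and] at huno
              rcases hKcl u (hK1K hu) w hw ha with h | rfl | rfl
              · exact hcl u hu w h ha
              · exact absurd ha.symm (huno.1 (hK1K hu))
              · exact absurd ha.symm (huno.2 (hK1K hu)))
          exact hKmiss z (hK1K hz) hz') hcK
      have hl2K : ∀ z ∈ y :: l2, z ∉ K := by
        intro z hz hzK
        obtain ⟨s, r, hsr⟩ := List.append_of_mem hz
        have hpz : NPath G (z :: r) := by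
          rw [hsr] at hlp1; exact (npath_append.1 hlp1).2.1
        have hsub : ∀ v ∈ z :: r, v ∈ y :: l2 := by intro v hv; rw [hsr]; simp at hv ⊢; tauto
        have hyr : y ∉ r := by
          intro hyr
          match s, hsr with
          | [], hsr => simp at hsr; rw [← hsr.1] at hzK; exact hyK hzK
          | b :: s, hsr =>
            simp at hsr
            have : y ∈ l2 := by rw [hsr.2]; simp [hyr]
            exact hyn this
        have hstay := stay_in (K := K) (D := D) hpz (fun v hv => hlD v (by
            have := hsub v (by simp [hv]); simp at this ⊢; tauto)) (by
          intro u hu w hw ha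
          rcases hKcl u hu w hw ha with h | rfl | rfl
          · exact Or.inr h
          · left; intro h; exact hxn (hsub _ (by simp [h]))
          · exact Or.inl hyr) hzK
        have hlastK : ∀ v ∈ z :: r, v ∈ K := by
          intro v hv; rcases List.mem_cons.1 hv with rfl | hv
          · exact hzK
          · exact hstay v hv
        obtain ⟨e, he⟩ : ∃ e, (z :: r).getLast? = some e := ⟨_, List.getLast?_eq_some_getLast (by simp)⟩
        have heY : e ∈ Y := hle' e (by rw [hsr, List.getLast?_append, he]; simp)
        exact hKmiss e (hlastK e (List.mem_of_mem_getLast? he)) (mem_union_right _ heY)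
      have := hcon (x :: (lK ++ y :: l2)) ⟨?_, ?_, by simp, by simpa using hxX, ?_⟩
      · simp at this; omega
      · rw [npath_cons, npath_append]
        refine ⟨⟨hk1, hlp1, fun z hz hz' => hl2K z hz' (hk2 z hz), ?_⟩, ?_, ?_⟩
        · intro e he w hw
          simp at hw; subst hw
          exact ((mem_filter.1 (hk5 e he)).2).symm
        · rw [List.mem_append]
          rintro (h | h)
          · exact hxK (hk2 x h)
          · exact hxn h
        · rw [List.head?_append, List.head?_eq_some_head hk3]
          intro w hw
          simp at hw; subst hw
          exact (mem_filter.1 (hk4 _ (by rw [List.head?_eq_some_head hk3]; simp))).2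
      · intro z hz
        rw [List.mem_cons, List.mem_append] at hz
        rcases hz with rfl | h | h
        · exact hxD
        · exact hKD (hk2 z h)
        · exact hlD z (by simp at h ⊢; tauto)
      · intro e he
        apply hle'
        have h9 : x :: (lK ++ y :: l2) = (x :: lK) ++ (y :: l2) := rfl
        have h10 : (y :: l2).getLast? = some ((y :: l2).getLast (by simp)) :=
          List.getLast?_eq_some_getLast (by simp)
        rw [h9, List.getLast?_append, h10] at he
        rw [h10]
        simpa using he
    · -- delete K
      have hDK : #(D \ K) < n := by
        rw [← hDn]; apply card_lt_card
        refine ⟨sdiff_subset, fun h => ?_⟩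
        obtain ⟨z, hz⟩ := hKne
        have := h (hKD hz); simp [hz] at this
      have hxDK : x ∈ D \ K := by simp [hxD, hxK]
      have hyDK : y ∈ D \ K := by simp [hyD, hyK]
      have hsubX : ∀ z, z ∈ X ∪ Y → z ∉ K := fun z hz hzK => hKmiss z hzK hz
      have hIH0 : Conn G (D \ K) := by
        intro K1 hK1 hne hcl
        by_cases hxy1 : x ∈ K1 ∨ y ∈ K1
        · have hboth : x ∈ K1 ∧ y ∈ K1 := by
            rcases hxy1 with h | h
            · exact ⟨h, hcl x h y hyDK hxy⟩
            · exact ⟨hcl y h x hxDK hxy.symm, h⟩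
          have := hconn (K1 ∪ K) (union_subset (hK1.trans sdiff_subset) hKD) (hne.mono subset_union_left) (by
            intro u hu w hw ha
            rw [mem_union] at hu ⊢
            by_cases hwK : w ∈ K
            · exact Or.inr hwK
            · left
              rcases hu with hu | hu
              · exact hcl u hu w (mem_sdiff.2 ⟨hw, hwK⟩) ha
              · rcases hKcl u hu w hw ha with h | rfl | rfl
                · exact absurd h hwK
                · exact hboth.1
                · exact hboth.2)
          apply hK1.antisymm
          intro z hz
          rw [mem_sdiff, ← this, mem_union] at hz
          tauto
        · push Not at hxy1
          have := hconn K1 (hK1.trans sdiff_subset) hne (by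
            intro u hu w hw ha
            by_cases hwK : w ∈ K
            · have huD := mem_sdiff.1 (hK1 hu)
              rcases hKcl w hwK u huD.1 ha.symm with h | rfl | rfl
              · exact absurd h huD.2
              · exact absurd hu hxy1.1
              · exact absurd hu hxy1.2
            · exact hcl u hu w (mem_sdiff.2 ⟨hw, hwK⟩) ha)
          exact absurd (this ▸ hxD) hxy1.1
      have hIH1 : Gad G (D \ K) X Y := by
        intro v hv K1 hK1 hne hcl
        have hvD := mem_sdiff.1 hv
        have hK1D : ∀ z ∈ K1, z ∈ D ∧ z ∉ K ∧ z ≠ v := fun z hz => by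
          have := hK1 hz; simp at this; tauto
        by_cases hxy1 : x ∈ K1 ∨ y ∈ K1
        · have hboth : (x ∈ K1 ∨ x = v) ∧ (y ∈ K1 ∨ y = v) := by
            rcases hxy1 with h | h
            · exact ⟨Or.inl h, hcl x h y hyDK hxy⟩
            · exact ⟨hcl y h x hxDK hxy.symm, Or.inl h⟩
          obtain ⟨z, hz, hz'⟩ := hgad v hvD.1 (K1 ∪ K) (by
              intro z hz
              rw [mem_union] at hz
              rcases hz with hz | hz
              · exact mem_erase.2 ⟨(hK1D z hz).2.2, (hK1D z hz).1⟩
              · exact mem_erase.2 ⟨by rintro rfl; exact hvD.2 hz, hKD hz⟩) (hne.mono subset_union_left) (by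
            intro u hu w hw ha
            rw [mem_union] at hu ⊢
            by_cases hwK : w ∈ K
            · exact Or.inl (Or.inr hwK)
            · rcases hu with hu | hu
              · rcases hcl u hu w (mem_sdiff.2 ⟨hw, hwK⟩) ha with h | h
                · exact Or.inl (Or.inl h)
                · exact Or.inr h
              · rcases hKcl u hu w hw ha with h | rfl | rfl
                · exact absurd h hwK
                · rcases hboth.1 with h | h
                  · exact Or.inl (Or.inl h)
                  · exact Or.inr h
                · rcases hboth.2 with h | h
                  · exact Or.inl (Or.inl h)
                  · exact Or.inr h)
          rcases mem_union.1 hz with h | h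
          · exact ⟨z, h, hz'⟩
          · exact absurd hz' (hKmiss z h)
        · push Not at hxy1
          exact hgad v hvD.1 K1 (fun z hz => mem_erase.2 ⟨(hK1D z hz).2.2, (hK1D z hz).1⟩) hne (by
            intro u hu w hw ha
            by_cases hwK : w ∈ K
            · rcases hKcl w hwK u (hK1D u hu).1 ha.symm with h | rfl | rfl
              · exact absurd h (hK1D u hu).2.1
              · exact absurd hu hxy1.1
              · exact absurd hu hxy1.2
            · exact hcl u hu w (mem_sdiff.2 ⟨hw, hwK⟩) ha)
      have hIH2 : 2 * τ * #(D \ K) ≤ IE G (D \ K) (D \ K) + 2 * #X + 2 * #Y := by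
        have hsp : D = K ∪ (D \ K) := by rw [union_sdiff_of_subset hKD]
        have h1 : IE G D D = IE G K K + IE G (D \ K) (D \ K) + 2 * IE G K (D \ K) := by
          conv_lhs => rw [hsp]
          exact IE_union_self G disjoint_sdiff
        have h2 : IE G K (D \ K) ≤ #(K.filter (G.Adj x)) + #(K.filter (G.Adj y)) := by
          have e : D \ K = ({x} ∪ {y}) ∪ ((D \ K) \ ({x} ∪ {y})) := by
            rw [union_sdiff_of_subset]
            intro z hz; simp at hz; rcases hz with rfl | rfl <;> assumption
          rw [e, IE_union_right G disjoint_sdiff, IE_union_right G (by simpa using hxy.ne),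
            IE_singleton_right, IE_singleton_right]
          rw [IE_eq_zero G (X := K)]
          · omega
          · intro u hu w hw ha
            simp only [mem_sdiff, mem_union, mem_singleton, not_or] at hw
            rcases hKcl u hu w hw.1.1 ha with h | h | h
            · exact hw.1.2 h
            · exact hw.2.1 h
            · exact hw.2.2 h
        have h3 : #D = #K + #(D \ K) := by
          rw [card_sdiff_of_subset hKD]; omega
        rw [h3, mul_add] at hcount
        omega
      obtain ⟨l, hl, hlt⟩ := ih _ hDK G (D \ K) X Y rfl
        (fun z hz => mem_sdiff.2 ⟨hXD hz, hsubX z (mem_union_left _ hz)⟩)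
        (fun z hz => mem_sdiff.2 ⟨hYD hz, hsubX z (mem_union_right _ hz)⟩) hX hY hIH0 hIH1 hIH2
      have := hcon l ⟨hl.1, fun z hz => (mem_sdiff.1 (hl.2.1 z hz)).1, hl.2.2⟩
      omega
  · -- Case B
    push Not at hA
    set c := #(D.filter (fun z => G.Adj x z ∧ G.Adj y z)) with hc
    set Y' : Finset V := if y ∈ Y then insert x (Y.erase y) else Y with hY'
    have hY'sub : ∀ z ∈ Y', z ∈ Y ∨ (z = x ∧ y ∈ Y) := by
      intro z hz
      rw [hY'] at hz
      split_ifs at hz with h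
      · simp at hz; tauto
      · exact Or.inl hz
    have hYsub : ∀ z ∈ Y, z ≠ y → z ∈ Y' := by
      intro z hz hzy
      rw [hY']; split_ifs
      · simp [hz, hzy]
      · exact hz
    by_cases hcτ : 1 + c + #X + #Y ≤ τ + #(X.erase y) + #Y'
    · have hIH0 : Y' ⊆ D.erase y := by
        intro z hz
        rw [hY'] at hz
        split_ifs at hz with h
        · simp at hz ⊢
          rcases hz with rfl | hz
          · exact ⟨hxy.ne, hxD⟩
          · exact ⟨hz.1, hYD hz.2⟩
        · exact mem_erase.2 ⟨by rintro rfl; exact h hz, hYD hz⟩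
      have hIH1 : Y'.Nonempty := by
        by_cases h : y ∈ Y
        · exact ⟨x, by simp [hY', h]⟩
        · rw [hY', if_neg h]; exact hY
      have hIH2 : Conn (contr G x y) (D.erase y) := by
        intro K hK hne hcl
        have hKD : ∀ z ∈ K, z ∈ D ∧ z ≠ y := fun z hz => by have := hK hz; simp at this; tauto
        by_cases hxK : x ∈ K
        · have := hconn (insert y K) (by
            intro z hz; rw [mem_insert] at hz; rcases hz with rfl | hz
            exacts [hyD, (hKD z hz).1]) (by simp) (by
            intro u hu w hw ha
            rw [mem_insert] at hu ⊢
            by_cases hwy : w = y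
            · exact Or.inl hwy
            right
            by_cases hwx : w = x
            · rw [hwx]; exact hxK
            rcases hu with rfl | hu
            · exact hcl x hxK w (mem_erase.2 ⟨hwy, hw⟩) ⟨Ne.symm hwx, Or.inr (Or.inl ⟨rfl, ha⟩)⟩
            · exact hcl u hu w (mem_erase.2 ⟨hwy, hw⟩) ⟨ha.ne, Or.inl ha⟩)
          rw [← this, erase_insert (fun h => (hKD y h).2 rfl)]
        · have := hconn K (fun z hz => (hKD z hz).1) hne (by
            intro u hu w hw ha
            by_cases hwy : w = y
            · subst hwy
              refine absurd (hcl u hu x (mem_erase.2 ⟨hxy.ne, hxD⟩) ⟨?_, Or.inr (Or.inr ⟨rfl, ha⟩)⟩) hxK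
              rintro rfl; exact hxK hu
            · exact hcl u hu w (mem_erase.2 ⟨hwy, hw⟩) ⟨ha.ne, Or.inl ha⟩)
          exact absurd (this ▸ hxD) hxK
      have hIH3 : Gad (contr G x y) (D.erase y) (X.erase y) Y' := by
        intro v hv K hK hne hcl
        have hvD := mem_erase.1 hv
        have hKD : ∀ z ∈ K, z ∈ D ∧ z ≠ y ∧ z ≠ v := fun z hz => by have := hK hz; simp at this; tauto
        by_cases hxK : x ∈ K
        · exact ⟨x, hxK, mem_union_left _ (mem_erase.2 ⟨hxy.ne, hxX⟩)⟩
        have hfin : ∀ z ∈ K, z ∈ X ∪ Y → z ∈ X.erase y ∪ Y' := by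
          intro z hz hz'
          rcases mem_union.1 hz' with h | h
          · exact mem_union_left _ (mem_erase.2 ⟨(hKD z hz).2.1, h⟩)
          · exact mem_union_right _ (hYsub z h (hKD z hz).2.1)
        by_cases hvx : v = x
        · subst hvx
          by_contra hno
          push Not at hno
          refine hA K (fun z hz => (hKD z hz).1) ⟨hne, hxK, fun h => (hKD y h).2.1 rfl, ?_,
            fun z hz hz' => hno z hz (hfin z hz hz')⟩
          intro u hu w hw ha
          by_cases hwy : w = y
          · exact Or.inr (Or.inr hwy)
          · rcases hcl u hu w (mem_erase.2 ⟨hwy, hw⟩) ⟨ha.ne, Or.inl ha⟩ with h | h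
            · exact Or.inl h
            · exact Or.inr (Or.inl h)
        · obtain ⟨z, hz, hz'⟩ := hgad v hvD.2 K (fun z hz => mem_erase.2 ⟨(hKD z hz).2.2, (hKD z hz).1⟩) hne (by
            intro u hu w hw ha
            by_cases hwy : w = y
            · subst hwy
              rcases hcl u hu x (mem_erase.2 ⟨hxy.ne, hxD⟩) ⟨by rintro rfl; exact hxK hu, Or.inr (Or.inr ⟨rfl, ha⟩)⟩ with h | h
              · exact absurd h hxK
              · exact absurd h.symm hvx
            · exact hcl u hu w (mem_erase.2 ⟨hwy, hw⟩) ⟨ha.ne, Or.inl ha⟩)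
          exact ⟨z, hz, hfin z hz hz'⟩
      have hIH4 : 2 * τ * #(D.erase y) ≤ IE (contr G x y) (D.erase y) (D.erase y) + 2 * #(X.erase y) + 2 * #Y' := by
        have h1 := contr_count hxy hxD hyD
        rw [← hc] at h1
        have h2 : #D = #(D.erase y) + 1 := (card_erase_add_one hyD).symm
        rw [h2, mul_add] at hcount
        omega
      obtain ⟨l, hl, hlt⟩ := ih (#(D.erase y)) (by rw [← hDn]; exact card_erase_lt_of_mem hyD)
        (contr G x y) (D.erase y) (X.erase y) Y' rfl (erase_subset_erase _ hXD) hIH0 ⟨x, by simp [hxX, hxy.ne]⟩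
        hIH1 hIH2 hIH3 hIH4
      obtain ⟨l', a1, a2, a3, a4, a5, a6⟩ := contr_lift hxy hxX hxD hyD hY'sub hl.1 hl.2.1 hl.2.2.1 hl.2.2.2.1 hl.2.2.2.2
      have := hcon l' ⟨a1, a2, a3, a4, a5⟩
      omega
    · have hX1 : #X ≤ #(X.erase y) + 1 := by
        have := pred_card_le_card_erase (s := X) (a := y); omega
      have hY1 : #Y ≤ #Y' + 1 := by
        rw [hY']; split_ifs
        · have := pred_card_le_card_erase (s := Y) (a := y)
          have h2 : #(Y.erase y) ≤ #(insert x (Y.erase y)) := card_le_card (subset_insert _ _)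
          omega
        · omega
      have hcge : τ ≤ c + 2 := by omega
      have hcommon : D.filter (fun z => G.Adj x z ∧ G.Adj y z) ⊆ l2.toFinset := by
        intro z hz
        rw [mem_filter] at hz
        obtain ⟨hzD, hxz, hyz⟩ := hz
        by_contra hzl
        rw [List.mem_toFinset] at hzl
        have := hmax (x :: z :: y :: l2) ⟨?_, ?_, by simp, by simpa using hxX, ?_⟩
        · simp at this
        · rw [npath_cons, npath_cons]
          refine ⟨⟨hlp1, ?_, by simpa using hyz.symm⟩, ?_, by simpa using hxz⟩
          · simp [hzl, hyz.ne.symm]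
          · simp at hxn ⊢; exact ⟨hxz.ne, hxn⟩
        · intro w hw
          rcases List.mem_cons.1 hw with rfl | hw
          · exact hxD
          rcases List.mem_cons.1 hw with rfl | hw
          · exact hzD
          exact hlD w (by simp at hw ⊢; tauto)
        · intro e he
          apply hle'
          simpa [List.getLast?_cons] using he
      have h1 : c ≤ l2.length := (card_le_card hcommon).trans (List.toFinset_card_le _)
      simp at hltau
      omega

end Part3

section Part4
open Finset
open scoped Classical

variable {V : Type}

/-- A list listing the vertices of a cycle in cyclic order. -/
def CycL (G : SimpleGraph V) (c : List V) : Prop :=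
  NPath G c ∧ 3 ≤ c.length ∧ (∀ h ∈ c.head?, ∀ e ∈ c.getLast?, G.Adj e h)

lemma cyc_rotate {G : SimpleGraph V} {a b : List V} (h : CycL G (a ++ b)) : CycL G (b ++ a) := by
  obtain ⟨h1, h2, h3⟩ := h
  by_cases ha : a = []
  · subst ha; simpa [CycL] using ⟨h1, h2, h3⟩
  by_cases hb : b = []
  · subst hb
    rw [List.append_nil] at h1 h2 h3
    exact ⟨h1, h2, h3⟩
  rw [npath_append] at h1
  obtain ⟨p1, p2, p3, p4⟩ := h1
  rw [List.head?_append, List.getLast?_append, List.head?_eq_some_head ha, List.getLast?_eq_some_getLast hb] at h3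
  rw [List.getLast?_eq_some_getLast ha, List.head?_eq_some_head hb] at p4
  refine ⟨npath_append.2 ⟨p2, p1, fun x hx hx' => p3 x hx' hx, ?_⟩, by simp at h2 ⊢; omega, ?_⟩
  · rw [List.head?_eq_some_head ha, List.getLast?_eq_some_getLast hb]
    simpa using h3
  · rw [List.head?_append, List.getLast?_append, List.getLast?_eq_some_getLast ha, List.head?_eq_some_head hb]
    simpa using p4

lemma cyc_reverse {G : SimpleGraph V} {c : List V} (h : CycL G c) : CycL G c.reverse := by
  obtain ⟨h1, h2, h3⟩ := h
  refine ⟨npath_reverse.2 h1, by simpa using h2, ?_⟩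
  intro a ha b hb
  rw [List.head?_reverse] at ha
  rw [List.getLast?_reverse] at hb
  exact (h3 b hb a ha).symm

lemma cyc_cons_reverse {G : SimpleGraph V} {v : V} {c : List V} (h : CycL G (v :: c)) : CycL G (v :: c.reverse) := by
  have := cyc_reverse h
  rw [List.reverse_cons] at this
  exact cyc_rotate this

lemma cyc_rotate_to {G : SimpleGraph V} {c : List V} {v : V} (h : CycL G c) (hv : v ∈ c) :
    ∃ c', CycL G (v :: c') ∧ ∀ z, z ∈ v :: c' ↔ z ∈ c := by
  obtain ⟨a, b, rfl⟩ := List.append_of_mem hv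
  refine ⟨b ++ a, cyc_rotate h, ?_⟩
  intro z; simp; tauto

lemma cyc_hasCycle {G : SimpleGraph V} {c : List V} (h : CycL G c) {k : ℕ} (hk : k ≤ c.length) :
    HasCycleGE G k := hasCycle_of_list h.1 h.2.1 h.2.2 hk

lemma cyc_step {G : SimpleGraph V} {W : Finset V} {x0 v w z : V} {q c1 c2 : List V}
    (hc : CycL G (v :: (c1 ++ z :: c2))) (hcW : ∀ y ∈ v :: (c1 ++ z :: c2), y ∈ W)
    (hq : NPath G (q ++ [z])) (hqW : ∀ y ∈ q ++ [z], y ∈ W.erase v)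
    (hqc : ∀ y ∈ q, y ∉ c1 ++ z :: c2) (hqh : (q ++ [z]).head? = some w) (hqne : q ≠ [])
    (hvw : G.Adj v w) (hx0 : x0 ∈ v :: c1 ++ [z]) :
    ∃ c, CycL G c ∧ (∀ y ∈ c, y ∈ W) ∧ c.head? = some w ∧ x0 ∈ c := by
  have hp := hc.1
  rw [← List.cons_append, npath_append] at hp
  obtain ⟨p1, p2, p3, p4⟩ := hp
  obtain ⟨w', q', rfl⟩ := List.exists_cons_of_ne_nil hqne
  simp at hqh
  subst hqh
  have hL : CycL G ((v :: c1) ++ (w' :: q' ++ [z]).reverse) := by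
    refine ⟨npath_append.2 ⟨p1, npath_reverse.2 hq, ?_, ?_⟩, by simp; omega, ?_⟩
    · intro y hy hy'
      rw [List.mem_reverse, List.mem_append] at hy'
      rcases hy' with h | h
      · rcases List.mem_cons.1 hy with rfl | hy
        · simpa using hqW y (by simp only [List.mem_append]; exact Or.inl h)
        · exact hqc y h (by simp [hy])
      · simp at h; subst h
        exact p3 y hy (by simp)
    · intro a ha b hb
      refine p4 a ha b ?_
      simpa using hb
    · intro a ha b hb
      simp at ha
      subst ha
      rw [List.reverse_append, List.reverse_cons, ← List.append_assoc, ← List.append_assoc] at hb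
      simp only [List.getLast?_append, List.getLast?_singleton] at hb
      simp at hb
      subst hb
      exact hvw.symm
  have hrev : (v :: c1) ++ (w' :: q' ++ [z]).reverse = ((v :: c1) ++ (q' ++ [z]).reverse) ++ [w'] := by simp
  rw [hrev] at hL
  have := cyc_rotate hL
  refine ⟨_, this, ?_, by simp, ?_⟩
  · intro y hy
    simp only [List.mem_append, List.mem_cons, List.mem_reverse, List.not_mem_nil, or_false] at hy
    rcases hy with h | (h | h) | h | h
    · exact mem_of_mem_erase (hqW y (by simp [h]))
    · exact hcW y (by simp [h])
    · exact hcW y (by simp [h])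
    · exact mem_of_mem_erase (hqW y (by simp [h]))
    · exact mem_of_mem_erase (hqW y (by simp [h]))
  · simp at hx0 ⊢; tauto

lemma cyc_common {G : SimpleGraph V} {W : Finset V} (hW : TwoC G W) {x0 v : V} (hx0 : x0 ∈ W) (hv : v ∈ W) :
    ∃ c, CycL G c ∧ (∀ y ∈ c, y ∈ W) ∧ c.head? = some v ∧ x0 ∈ c := by
  let P : V → Prop := fun v => ∃ c, CycL G c ∧ (∀ y ∈ c, y ∈ W) ∧ c.head? = some v ∧ x0 ∈ c
  have key : W.filter P = W := by
    apply hW.conn _ (filter_subset _ _)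
    · refine ⟨x0, mem_filter.2 ⟨hx0, ?_⟩⟩
      have h3 := hW.1
      obtain ⟨y1, hy1, ha1⟩ : ∃ y ∈ W, G.Adj x0 y := by
        by_contra hno
        push Not at hno
        have := hW.conn {x0} (by simpa using hx0) (by simp) (by
          intro u hu w hw ha; simp at hu; subst hu; exact absurd ha (hno w hw))
        rw [← this] at h3; simp at h3
      have hx1 : x0 ∈ W.erase y1 := mem_erase.2 ⟨ha1.ne, hx0⟩
      obtain ⟨y2, hy2, ha2⟩ : ∃ y ∈ W.erase y1, G.Adj x0 y := by
        by_contra hno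
        push Not at hno
        have := hW.conn_erase y1 {x0} (by simpa using hx1) (by simp) (by
          intro u hu w hw ha; simp at hu; subst hu; exact absurd ha (hno w hw))
        have h4 := card_erase_of_mem hy1
        rw [← this] at h4; simp at h4; omega
      have hne := (mem_erase.1 hy2).1
      obtain ⟨l, hl, hlW, hlh, hle⟩ := exists_path (hW.conn_erase x0) (mem_erase.2 ⟨ha1.ne.symm, hy1⟩)
        (mem_erase.2 ⟨ha2.ne.symm, (mem_erase.1 hy2).2⟩)
      refine ⟨x0 :: l, ⟨npath_cons.2 ⟨hl, fun h => by simpa using hlW _ h, ?_⟩, ?_, ?_⟩, ?_, by simp, by simp⟩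
      · rw [hlh]; simpa using ha1
      · match l, hlh, hle with
        | [a], h1, h2 => simp at h1 h2; exact absurd (h2.symm.trans h1) hne
        | a :: b :: l, _, _ => simp
      · intro a ha b hb
        rw [List.getLast?_cons, hle] at hb
        simp at ha hb
        subst ha; subst hb
        exact ha2.symm
      · intro y hy
        rcases List.mem_cons.1 hy with rfl | hy
        · exact hx0
        · exact mem_of_mem_erase (hlW y hy)
    · intro v hv w hw hvw
      rw [mem_filter] at hv ⊢
      obtain ⟨hvW, c, hc, hcW, hch, hxc⟩ := hv
      refine ⟨hw, ?_⟩
      by_cases hwc : w ∈ c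
      · obtain ⟨c', hc', hm⟩ := cyc_rotate_to hc hwc
        exact ⟨_, hc', fun y hy => hcW y ((hm y).1 hy), by simp, (hm x0).2 hxc⟩
      · obtain ⟨v', c', rfl⟩ : ∃ v' c', c = v' :: c' := by
          match c, hch with
          | a :: b, _ => exact ⟨a, b, rfl⟩
        simp at hch
        subst hch
        have hvc' : v' ∉ c' := (npath_cons.1 hc.1).2.1
        have hne : c'.toFinset.Nonempty := by
          match c', hc.2.1 with
          | a :: b, _ => exact ⟨a, by simp⟩
          | [], h => simp at h
        obtain ⟨q, z, hz, hq, hqW, hqT, hqh⟩ := exists_path_to (hW.conn_erase v') hne (by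
            intro y hy
            rw [List.mem_toFinset] at hy
            exact mem_erase.2 ⟨by rintro rfl; exact hvc' hy, hcW y (by simp [hy])⟩)
          (u := w) (mem_erase.2 ⟨hvw.ne.symm, hw⟩)
        rw [List.mem_toFinset] at hz
        have hqT' : ∀ y ∈ q, y ∉ c' := fun y hy => by simpa using hqT y hy
        have hqne : q ≠ [] := by
          rintro rfl
          simp at hqh; subst hqh
          exact hwc (by simp [hz])
        obtain ⟨c1, c2, rfl⟩ := List.append_of_mem hz
        by_cases hx : x0 ∈ v' :: c1 ++ [z]
        · exact cyc_step hc hcW hq hqW hqT' hqh hqne hvw hx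
        · have hrev : (c1 ++ z :: c2).reverse = c2.reverse ++ z :: c1.reverse := by simp
          have hc' := cyc_cons_reverse hc
          rw [hrev] at hc'
          refine cyc_step hc' ?_ hq hqW ?_ hqh hqne hvw ?_
          · intro y hy; apply hcW; simp at hy ⊢; tauto
          · intro y hy h; apply hqT' y hy; simp at h ⊢; tauto
          · simp at hx hxc ⊢; tauto
  rw [← key] at hv
  exact (mem_filter.1 hv).2

lemma gap_lemma (C : V → Prop) {g : ℕ} (hg : 1 ≤ g) : ∀ (n : ℕ) (l : List V), l.length = n →
    l ≠ [] → (∀ h ∈ l.head?, C h) → (∀ e ∈ l.getLast?, C e) →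
    (∃ l1 u m v l2, l = l1 ++ ((u :: m) ++ v :: l2) ∧ C u ∧ C v ∧ (∀ y ∈ m, ¬ C y) ∧ g ≤ m.length) ∨
      l.length ≤ g * (l.filter C).length := by
  intro n
  induction n using Nat.strong_induction_on with
  | _ n ih =>
  intro l hn hne hh he
  obtain ⟨x, l', rfl⟩ := List.exists_cons_of_ne_nil hne
  have hx : C x := hh x (by simp)
  by_cases hl' : l' = []
  · subst hl'; right; simp [hx]; exact hg
  have heq := List.takeWhile_append_dropWhile (p := fun y => decide (¬ C y)) (l := l')
  set m := l'.takeWhile (fun y => decide (¬ C y)) with hm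
  have hmC : ∀ y ∈ m, ¬ C y := fun y hy => by
    have := List.mem_takeWhile_imp hy
    simpa using this
  have hlast : ∀ e ∈ l'.getLast?, C e := by
    intro e he'; apply he; rw [List.getLast?_cons]; rw [Option.mem_def] at he'; simp [he']
  cases hr : l'.dropWhile (fun y => decide (¬ C y)) with
  | nil =>
    exfalso
    rw [hr, List.append_nil] at heq
    obtain ⟨e, he'⟩ : ∃ e, l'.getLast? = some e := ⟨_, List.getLast?_eq_some_getLast hl'⟩
    exact hmC e (heq ▸ List.mem_of_mem_getLast? he') (hlast e he')
  | cons v r =>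
    have hv : C v := by
      have := List.head?_dropWhile_not (p := fun y => decide (¬ C y)) (l := l')
      rw [hr] at this
      simpa using this
    rw [hr] at heq
    by_cases hgm : g ≤ m.length
    · left
      exact ⟨[], x, m, v, r, by rw [← heq]; simp, hx, hv, hmC, hgm⟩
    · rcases ih (v :: r).length (by rw [← hn, ← heq]; simp) (v :: r) rfl (by simp) (by simpa using hv) (by
        intro e he'; apply hlast; rw [← heq, List.getLast?_append]; rw [Option.mem_def] at he'; simp [he']) with h | h
      · left
        obtain ⟨l1, u, m', v', l2, h1, h2⟩ := h
        exact ⟨x :: m ++ l1, u, m', v', l2, by rw [← heq, h1]; simp, h2⟩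
      · right
        have : ((x :: l').filter C).length = 1 + ((v :: r).filter C).length := by
          rw [← heq]
          have : m.filter (fun y => decide (C y)) = [] := by
            rw [List.filter_eq_nil_iff]; simpa using hmC
          simp only [List.filter_cons, List.filter_append, hx, this]; simp; omega
        rw [this, mul_add]
        rw [← heq]
        simp only [List.length_cons, List.length_append] at h ⊢
        omega

/-- Paths in a 2-connected graph of bounded circumference are bounded. -/
lemma path_bound {G : SimpleGraph V} {t : ℕ} (ht : 1 ≤ t) (hG : ¬ HasCycleGE G (2 * t + 1))
    {W : Finset V} (hW : TwoC G W) {l : List V} (hl : NPath G l) (hlW : ∀ x ∈ l, x ∈ W) :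
    l.length ≤ 2 * t * (2 * t) := by
  by_cases hne : l = []
  · subst hne; simp
  obtain ⟨c, hc, hcW, hch, hxc⟩ := cyc_common hW (hlW _ (List.head_mem hne)) (hlW _ (List.getLast_mem hne))
  have hclen : c.length ≤ 2 * t := by
    by_contra h
    exact hG (cyc_hasCycle hc (by omega))
  rcases gap_lemma (fun y => y ∈ c) (g := 2 * t) (by omega) _ l rfl hne (by
      rw [List.head?_eq_some_head hne]; simpa using hxc) (by
      rw [List.getLast?_eq_some_getLast hne]; simpa using List.mem_of_mem_head? hch) with h | h
  · obtain ⟨l1, u, m, v, l2, rfl, hu, hv, hm, hgm⟩ := h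
    exfalso
    have hp := (npath_append.1 hl).2.1
    obtain ⟨p1, p2, p3, p4⟩ := npath_append.1 hp
    have huv : u ≠ v := by rintro rfl; exact p3 u (by simp) (by simp)
    obtain ⟨c', hc', hmem⟩ := cyc_rotate_to hc hv
    have hu' : u ∈ c' := by
      have := (hmem u).2 hu
      simpa [huv] using this
    obtain ⟨c1, c2, rfl⟩ := List.append_of_mem hu'
    have hp2 := hc'.1
    rw [← List.cons_append, npath_append] at hp2
    obtain ⟨r1, r2, r3, r4⟩ := hp2
    refine hG (hasCycle_of_list (l := (u :: m) ++ (v :: c1)) (npath_append.2 ⟨p1, r1, ?_, ?_⟩) ?_ ?_ ?_)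
    · intro y hy hy'
      rcases List.mem_cons.1 hy with rfl | hy
      · exact r3 y hy' (by simp)
      · apply hm y hy
        apply (hmem y).1; rw [← List.cons_append]; exact List.mem_append_left _ hy'
    · intro a ha b hb
      exact p4 a ha b (by simpa using hb)
    · simp; omega
    · intro a ha b hb
      simp at ha; subst ha
      apply r4 b _ u (by simp)
      have h10 : (v :: c1).getLast? = some ((v :: c1).getLast (by simp)) :=
          List.getLast?_eq_some_getLast (by simp)
      rw [List.getLast?_append, h10] at hb
      rw [h10]
      simpa using hb
    · simp; omega
  · refine h.trans ?_
    apply Nat.mul_le_mul_left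
    have key : ∀ l' : List V, l'.Nodup → (∀ y ∈ l', y ∈ c) → l'.length ≤ 2 * t := by
      intro l' hl' hlc
      rw [← List.toFinset_card_of_nodup hl']
      refine le_trans (card_le_card (t := c.toFinset) ?_) ((List.toFinset_card_le _).trans hclen)
      intro y hy
      simp at hy ⊢
      exact hlc y hy
    exact key _ (hl.2.filter _) (fun y hy => by simpa using (List.mem_filter.1 hy).2)

end Part4

section Part5
open Finset
open scoped Classical

variable {V : Type}

lemma many_pieces {G : SimpleGraph V} {W : Finset V} {m B : ℕ} : ∀ (j : ℕ) (S R : Finset V) (v : V),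
    S ⊆ W → R ⊆ W → v ∈ R → Disjoint S R → Conn G R →
    (∀ u ∈ R, ∀ w ∈ W, G.Adj u w → w ∈ R ∨ w ∈ S) →
    (∀ l, NPath G (v :: l) → (∀ x ∈ v :: l, x ∈ R) → (v :: l).length ≤ j) →
    (m + 1) ^ j < #R → (m + 1) ^ j ≤ B →
    ∃ S' ⊆ W, #S' ≤ #S + j ∧ ∃ 𝒟 : Finset (Finset V), m ≤ #𝒟 ∧
      (∀ D ∈ 𝒟, D.Nonempty ∧ Conn G D ∧ D ⊆ W ∧ Disjoint D S' ∧ #D ≤ B ∧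
        (∀ u ∈ D, ∀ w ∈ W, G.Adj u w → w ∈ D ∨ w ∈ S')) ∧
      (∀ D ∈ 𝒟, ∀ D' ∈ 𝒟, D ≠ D' → Disjoint D D') := by
  intro j
  induction j with
  | zero =>
    intro S R v _ _ hv _ _ _ hpath
    have := hpath [] (npath_singleton v) (by simpa using hv)
    simp at this
  | succ j ih =>
    intro S R v hSW hRW hv hdis hconn hcl hpath hR hB
    have hS1 : insert v S ⊆ W := insert_subset (hRW hv) hSW
    have hc1 : #(insert v S) ≤ #S + 1 := card_insert_le _ _
    have hjB : (m + 1) ^ j ≤ B := le_trans (Nat.pow_le_pow_right (by omega) (by omega)) hB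
    have hclR : ∀ K ∈ comps G (R.erase v), ∀ u ∈ K, ∀ w ∈ W, G.Adj u w → w ∈ K ∨ w ∈ insert v S := by
      intro K hK u hu w hw ha
      rw [mem_comps] at hK
      have huR := hK.1 hu
      rcases hcl u (mem_of_mem_erase huR) w hw ha with h | h
      · by_cases hwv : w = v
        · right; simp [hwv]
        · left; exact hK.2.2.2 u hu w (mem_erase.2 ⟨hwv, h⟩) ha
      · right; simp [h]
    have hdisK : ∀ K ∈ comps G (R.erase v), Disjoint K (insert v S) := by
      intro K hK
      rw [mem_comps] at hK
      rw [Finset.disjoint_left]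
      intro z hz hz'
      have := mem_erase.1 (hK.1 hz)
      rw [mem_insert] at hz'
      rcases hz' with h | h
      · exact this.1 h
      · exact Finset.disjoint_left.1 hdis h this.2
    by_cases hbig : ∃ K ∈ comps G (R.erase v), (m + 1) ^ j < #K
    · obtain ⟨K, hK, hKbig⟩ := hbig
      have hK' := mem_comps.1 hK
      have hKR : K ⊆ R := hK'.1.trans (erase_subset _ _)
      obtain ⟨v', hv', hvv'⟩ : ∃ v' ∈ K, G.Adj v v' := by
        by_contra hno
        push Not at hno
        have := hconn K hKR hK'.2.1 (by
          intro u hu w hw ha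
          by_cases hwv : w = v
          · subst hwv; exact absurd ha.symm (hno u hu)
          · exact hK'.2.2.2 u hu w (mem_erase.2 ⟨hwv, hw⟩) ha)
        have h2 := hK'.1 (this ▸ hv)
        simp at h2
      obtain ⟨S', h1, h2, h3⟩ := ih (insert v S) K v' hS1 (hKR.trans hRW) hv' (hdisK K hK).symm hK'.2.2.1
        (hclR K hK) (by
          intro l hl hlK
          have := hpath (v' :: l) (npath_cons.2 ⟨hl, fun h => by simpa using hK'.1 (hlK v h), by simpa using hvv'⟩) (by
            intro x hx
            rcases List.mem_cons.1 hx with rfl | hx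
            · exact hv
            · exact hKR (hlK x hx))
          simp at this ⊢; exact this) hKbig hjB
      exact ⟨S', h1, by omega, h3⟩
    · push Not at hbig
      refine ⟨insert v S, hS1, by omega, comps G (R.erase v), ?_, ?_, fun D hD D' hD' => comps_disjoint hD hD'⟩
      · have hcov : R.erase v ⊆ (comps G (R.erase v)).biUnion id := by
          intro z hz
          obtain ⟨K, hK, hzK⟩ := exists_comp (G := G) hz
          exact mem_biUnion.2 ⟨K, hK, hzK⟩
        have h1 := (card_le_card hcov).trans (card_biUnion_le_card_mul _ _ _ hbig)
        rw [card_erase_of_mem hv] at h1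
        have h2 : (m + 1) ^ (j + 1) ≤ #(comps G (R.erase v)) * (m + 1) ^ j := by omega
        rw [pow_succ, mul_comm] at h2
        have := Nat.le_of_mul_le_mul_right h2 (by positivity)
        omega
      · intro D hD
        have hD' := mem_comps.1 hD
        exact ⟨hD'.2.1, hD'.2.2.1, (hD'.1.trans (erase_subset _ _)).trans hRW, hdisK D hD, (hbig D hD).trans hjB,
          hclR D hD⟩

/-- Many bounded connected pieces with the same attachment set. -/
def Pieces (G : SimpleGraph V) (W A : Finset V) (𝒟 : Finset (Finset V)) (B : ℕ) : Prop :=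
  A ⊆ W ∧ 2 ≤ #A ∧ (∀ D ∈ 𝒟, D.Nonempty ∧ Conn G D ∧ D ⊆ W ∧ Disjoint D A ∧ #D ≤ B ∧
    (∀ u ∈ D, ∀ w ∈ W, G.Adj u w → w ∈ D ∨ w ∈ A) ∧ (∀ a ∈ A, ∃ u ∈ D, G.Adj a u)) ∧
    (∀ D ∈ 𝒟, ∀ D' ∈ 𝒟, D ≠ D' → Disjoint D D')

lemma exists_pieces {G : SimpleGraph V} {t : ℕ} (ht : 1 ≤ t) (hG : ¬ HasCycleGE G (2 * t + 1))
    {W : Finset V} (hW : TwoC G W) {m0 : ℕ} (hm0 : 2 ≤ m0)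
    (hbig : (m0 * 2 ^ (2 * t * (2 * t)) + 1) ^ (2 * t * (2 * t)) < #W) :
    ∃ A 𝒟, m0 ≤ #𝒟 ∧ Pieces G W A 𝒟 ((m0 * 2 ^ (2 * t * (2 * t)) + 1) ^ (2 * t * (2 * t))) := by
  set L := 2 * t * (2 * t) with hL
  obtain ⟨v, hv⟩ : W.Nonempty := card_pos.1 (by have := hW.1; omega)
  obtain ⟨S', hS'W, hS', 𝒟, h𝒟, hprop, hdisj⟩ := many_pieces (G := G) (W := W) (m := m0 * 2 ^ L)
    (B := (m0 * 2 ^ L + 1) ^ L) L ∅ W v (by simp) subset_rfl hv (by simp) hW.conn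
    (fun u _ w hw _ => Or.inl hw) (fun l hl hlW => path_bound ht hG hW hl hlW) hbig le_rfl
  let f : Finset V → Finset V := fun D => S'.filter (fun a => ∃ u ∈ D, G.Adj a u)
  have hmaps : ∀ D ∈ 𝒟, f D ∈ S'.powerset := fun D _ => mem_powerset.2 (filter_subset _ _)
  have hcard : #S'.powerset * m0 ≤ #𝒟 := by
    rw [card_powerset]
    have : 2 ^ #S' ≤ 2 ^ L := Nat.pow_le_pow_right (by omega) (by simpa using hS')
    calc _ ≤ 2 ^ L * m0 := Nat.mul_le_mul_right _ this
      _ = m0 * 2 ^ L := mul_comm _ _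
      _ ≤ _ := h𝒟
  obtain ⟨A, hA, hAc⟩ := exists_le_card_fiber_of_mul_le_card_of_maps_to hmaps ⟨∅, by simp⟩ hcard
  rw [mem_powerset] at hA
  have hp : ∀ D ∈ 𝒟.filter (fun D => f D = A), D.Nonempty ∧ Conn G D ∧ D ⊆ W ∧ Disjoint D A ∧
      #D ≤ (m0 * 2 ^ L + 1) ^ L ∧
    (∀ u ∈ D, ∀ w ∈ W, G.Adj u w → w ∈ D ∨ w ∈ A) ∧ (∀ a ∈ A, ∃ u ∈ D, G.Adj a u) := by
    intro D hD
    rw [mem_filter] at hD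
    obtain ⟨hD, hDA⟩ := hD
    obtain ⟨h1, h2, h3, h4, h5, h6⟩ := hprop D hD
    refine ⟨h1, h2, h3, disjoint_of_subset_right hA h4, h5, ?_, ?_⟩
    · intro u hu w hw ha
      rcases h6 u hu w hw ha with h | h
      · exact Or.inl h
      · right; rw [← hDA]; exact mem_filter.2 ⟨h, u, hu, ha.symm⟩
    · intro a ha
      rw [← hDA] at ha
      exact (mem_filter.1 ha).2
  have hdj : ∀ D ∈ 𝒟.filter (fun D => f D = A), ∀ D' ∈ 𝒟.filter (fun D => f D = A), D ≠ D' → Disjoint D D' :=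
    fun D hD D' hD' => hdisj D (mem_filter.1 hD).1 D' (mem_filter.1 hD').1
  refine ⟨A, 𝒟.filter (fun D => f D = A), hAc, hA.trans hS'W, ?_, hp, hdj⟩
  by_contra hlt
  obtain ⟨D, hD, D', hD', hne⟩ := one_lt_card.1 (show 1 < #(𝒟.filter (fun D => f D = A)) by omega)
  obtain ⟨h1, h2, h3, h4, h5, h6, h7⟩ := hp D hD
  obtain ⟨h1', h2', h3', h4', h5', h6', h7'⟩ := hp D' hD'
  have := hW.2 A (by omega) D (fun z hz => mem_sdiff.2 ⟨h3 hz, Finset.disjoint_left.1 h4 hz⟩) h1 (by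
    intro u hu w hw ha
    rw [mem_sdiff] at hw
    rcases h6 u hu w hw.1 ha with h | h
    · exact h
    · exact absurd h hw.2)
  obtain ⟨z, hz⟩ := h1'
  have hzD : z ∈ D := by
    rw [this]; exact mem_sdiff.2 ⟨h3' hz, Finset.disjoint_left.1 h4' hz⟩
  exact Finset.disjoint_left.1 (hdj D hD D' hD' hne) hzD hz

/-- A path in `D` linking `a` and `b` with at least `n` internal vertices. -/
def Link (G : SimpleGraph V) (D : Finset V) (a b : V) (n : ℕ) : Prop :=
  ∃ p : List V, NPath G p ∧ p ≠ [] ∧ (∀ x ∈ p, x ∈ D) ∧ (∀ h ∈ p.head?, G.Adj a h) ∧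
    (∀ e ∈ p.getLast?, G.Adj e b) ∧ n ≤ p.length

lemma Link.symm {G : SimpleGraph V} {D : Finset V} {a b : V} {n : ℕ} (h : Link G D a b n) : Link G D b a n := by
  obtain ⟨p, h1, h2, h3, h4, h5, h6⟩ := h
  refine ⟨p.reverse, npath_reverse.2 h1, by simpa using h2, by simpa using h3, ?_, ?_, by simpa using h6⟩
  · rw [List.head?_reverse]; intro x hx; exact (h5 x hx).symm
  · rw [List.getLast?_reverse]; intro x hx; exact (h4 x hx).symm

lemma link_one {G : SimpleGraph V} {D : Finset V} {a b u v : V} (hD : Conn G D) (hu : u ∈ D) (hv : v ∈ D)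
    (hau : G.Adj a u) (hbv : G.Adj b v) : Link G D a b 1 := by
  obtain ⟨l, h1, h2, h3, h4⟩ := exists_path hD hu hv
  have hne : l ≠ [] := by rintro rfl; simp at h3
  refine ⟨l, h1, hne, h2, ?_, ?_, List.length_pos_iff.2 hne⟩
  · rw [h3]; simpa using hau
  · rw [h4]; simpa using hbv.symm

lemma necklace_aux {G : SimpleGraph V} (a : ℕ → V) (p : ℕ → List V) (s : ℕ)
    (hp : ∀ i ≤ s, NPath G (a i :: p i) ∧ p i ≠ [])
    (hadj : ∀ i < s, ∀ e ∈ (p i).getLast?, G.Adj e (a (i + 1)))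
    (hdis : ∀ i ≤ s, ∀ j ≤ s, i ≠ j → ∀ x ∈ a i :: p i, x ∉ a j :: p j) :
    ∃ l, NPath G l ∧ l.head? = some (a 0) ∧ l.getLast? = (p s).getLast? ∧
      (∀ x ∈ l, ∃ i ≤ s, x ∈ a i :: p i) ∧ l.length = ∑ i ∈ range (s + 1), (1 + (p i).length) := by
  induction s with
  | zero =>
    refine ⟨a 0 :: p 0, (hp 0 le_rfl).1, by simp, ?_, fun x hx => ⟨0, le_rfl, hx⟩, by simp [add_comm]⟩
    rw [List.getLast?_cons, List.getLast?_eq_some_getLast (hp 0 le_rfl).2]; simp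
  | succ s ih =>
    obtain ⟨l, h1, h2, h3, h4, h5⟩ := ih (fun i hi => hp i (by omega)) (fun i hi => hadj i (by omega))
      (fun i hi j hj => hdis i (by omega) j (by omega))
    refine ⟨l ++ (a (s + 1) :: p (s + 1)), ?_, ?_, ?_, ?_, ?_⟩
    · rw [npath_append]
      refine ⟨h1, (hp _ le_rfl).1, ?_, ?_⟩
      · intro x hx
        obtain ⟨i, hi, hxi⟩ := h4 x hx
        exact hdis i (by omega) (s + 1) le_rfl (by omega) x hxi
      · intro e he y hy
        simp at hy; subst hy
        rw [h3] at he
        exact hadj s (by omega) e he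
    · rw [List.head?_append, h2]; simp
    · rw [List.getLast?_append, List.getLast?_cons, List.getLast?_eq_some_getLast (hp _ le_rfl).2]; simp
    · intro x hx
      rw [List.mem_append] at hx
      rcases hx with h | h
      · obtain ⟨i, hi, hxi⟩ := h4 x h
        exact ⟨i, by omega, hxi⟩
      · exact ⟨s + 1, le_rfl, h⟩
    · rw [sum_range_succ, ← h5]; simp; omega

lemma necklace {G : SimpleGraph V} {s : ℕ} (hs : 2 ≤ s) (a : ℕ → V) (D : ℕ → Finset V) (n : ℕ → ℕ)
    (ha : ∀ i < s, ∀ j < s, a i = a j → i = j)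
    (hD : ∀ i < s, ∀ j < s, i ≠ j → Disjoint (D i) (D j))
    (haD : ∀ i < s, ∀ j < s, a i ∉ D j)
    (hl : ∀ i < s, Link G (D i) (a i) (a ((i + 1) % s)) (n i)) :
    HasCycleGE G (∑ i ∈ range s, (1 + n i)) := by
  choose! p h1 h2 h3 h4 h5 h6 using hl
  obtain ⟨s, rfl⟩ : ∃ r, s = r + 1 := ⟨s - 1, by omega⟩
  obtain ⟨l, g1, g2, g3, g4, g5⟩ := necklace_aux (G := G) a p s (by
      intro i hi
      refine ⟨npath_cons.2 ⟨h1 i (by omega), fun h => haD i (by omega) i (by omega) (h3 i (by omega) _ h), h4 i (by omega)⟩, h2 i (by omega)⟩) (by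
      intro i hi e he
      have := h5 i (by omega) e he
      rwa [Nat.mod_eq_of_lt (by omega)] at this) (by
      intro i hi j hj hij x hx hx'
      rw [List.mem_cons] at hx hx'
      rcases hx with rfl | hx <;> rcases hx' with h | hx'
      · exact hij (ha i (by omega) j (by omega) h)
      · exact haD i (by omega) j (by omega) (h3 j (by omega) _ hx')
      · subst h; exact haD j (by omega) i (by omega) (h3 i (by omega) _ hx)
      · exact Finset.disjoint_left.1 (hD i (by omega) j (by omega) hij) (h3 i (by omega) _ hx) (h3 j (by omega) _ hx'))
  have hle : ∑ i ∈ range (s + 1), (1 + n i) ≤ l.length := by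
    rw [g5]
    refine sum_le_sum fun i hi => ?_
    have := h6 i (by simpa using hi); omega
  have hpos : ∀ i ∈ range (s + 1), 2 ≤ 1 + (p i).length := by
    intro i hi
    have := List.length_pos_iff.2 (h2 i (by simpa using hi)); omega
  have h4s : 3 ≤ l.length := by
    rw [g5]
    have := sum_le_sum hpos
    simp at this; omega
  refine hasCycle_of_list g1 h4s ?_ hle
  intro h hh e he
  rw [g2] at hh; rw [g3] at he
  simp at hh; subst hh
  have := h5 s (by omega) e he
  rwa [Nat.mod_self] at this

end Part5

section Part6
open Finset
open scoped Classical

variable {V : Type}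

lemma list_fn {β : Type} (l : List β) (hl : l.Nodup) (hne : l ≠ []) : ∃ e : ℕ → β,
    (∀ i < l.length, e i ∈ l) ∧ (∀ i < l.length, ∀ j < l.length, e i = e j → i = j) ∧
    ∀ i x, l[i]? = some x → e i = x := by
  refine ⟨fun i => (l[i]?).getD (l.head hne), ?_, ?_, ?_⟩
  · intro i hi; simp [List.getElem?_eq_getElem hi]
  · intro i hi j hj h
    simp only [List.getElem?_eq_getElem hi, List.getElem?_eq_getElem hj, Option.getD_some] at h
    exact (hl.getElem_inj_iff).1 h
  · intro i x h; simp [h]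

lemma enum_finset {β : Type} (S : Finset β) (hS : S.Nonempty) (l0 : List β) (h0 : l0.Nodup) (h0S : ∀ x ∈ l0, x ∈ S) :
    ∃ e : ℕ → β, (∀ i < #S, e i ∈ S) ∧ (∀ i < #S, ∀ j < #S, e i = e j → i = j) ∧
    ∀ i x, l0[i]? = some x → e i = x := by
  have hnd : (l0 ++ (S \ l0.toFinset).toList).Nodup := by
    rw [List.nodup_append]
    refine ⟨h0, nodup_toList _, ?_⟩
    rintro a ha b hb rfl
    simp [ha] at hb
  have hmem : ∀ x, x ∈ l0 ++ (S \ l0.toFinset).toList ↔ x ∈ S := by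
    intro x
    simp only [List.mem_append, mem_toList, mem_sdiff, List.mem_toFinset]
    constructor
    · rintro (h | h)
      · exact h0S x h
      · exact h.1
    · intro h; by_cases hx : x ∈ l0
      · exact Or.inl hx
      · exact Or.inr ⟨h, hx⟩
  have hlen : (l0 ++ (S \ l0.toFinset).toList).length = #S := by
    rw [← List.toFinset_card_of_nodup hnd]
    congr 1; ext x; rw [List.mem_toFinset, hmem]
  obtain ⟨e, h1, h2, h3⟩ := list_fn _ hnd (by
    intro h; rw [h] at hlen; simp at hlen; exact hS.ne_empty (Finset.card_eq_zero.1 hlen.symm))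
  rw [hlen] at h1 h2
  refine ⟨e, fun i hi => (hmem _).1 (h1 i hi), h2, ?_⟩
  intro i x h
  apply h3
  rw [List.getElem?_append_left]
  · exact h
  · by_contra hh; rw [List.getElem?_eq_none (by omega)] at h; simp at h

/-- too many attachment vertices -/
lemma pieces_card_le {G : SimpleGraph V} {t : ℕ} (ht : 1 ≤ t) (hG : ¬ HasCycleGE G (2 * t + 1))
    {W A : Finset V} {𝒟 : Finset (Finset V)} {B : ℕ} (h : Pieces G W A 𝒟 B) (h𝒟 : t + 1 ≤ #𝒟) : #A ≤ t := by
  by_contra hlt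
  obtain ⟨hAW, hA2, hp, hdj⟩ := h
  obtain ⟨a, a1, a2, -⟩ := enum_finset A (card_pos.1 (by omega)) [] (by simp) (by simp)
  obtain ⟨E, e1, e2, -⟩ := enum_finset 𝒟 (card_pos.1 (by omega)) [] (by simp) (by simp)
  have := necklace (G := G) (s := t + 1) (by omega) a E (fun _ => 1)
    (fun i hi j hj => a2 i (by omega) j (by omega))
    (fun i hi j hj hij => hdj _ (e1 i (by omega)) _ (e1 j (by omega)) (fun h => hij (e2 i (by omega) j (by omega) h)))
    (fun i hi j hj h => Finset.disjoint_left.1 (hp _ (e1 j (by omega))).2.2.2.1 h (a1 i (by omega)))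
    (fun i hi => by
      have hm : (i + 1) % (t + 1) < t + 1 := Nat.mod_lt _ (by omega)
      obtain ⟨_, hc, _, _, _, _, hat⟩ := hp _ (e1 i (by omega))
      obtain ⟨u, hu, hau⟩ := hat _ (a1 i (by omega))
      obtain ⟨v, hv, hbv⟩ := hat _ (a1 ((i + 1) % (t + 1)) (by omega))
      exact link_one hc hu hv hau hbv)
  apply hG
  obtain ⟨v, w, hw, hlen⟩ := this
  refine ⟨v, w, hw, ?_⟩
  simp at hlen
  omega

lemma order_lemma {A : Finset V} {a b c d : V} (ha : a ∈ A) (hb : b ∈ A) (hc : c ∈ A) (hd : d ∈ A)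
    (hab : a ≠ b) (hcd : c ≠ d) (h : #A = 2 ∨ (c ≠ a ∧ c ≠ b)) :
    ∃ e : ℕ → V, (∀ i < #A, e i ∈ A) ∧ (∀ i < #A, ∀ j < #A, e i = e j → i = j) ∧
      ((e 0 = a ∧ e 1 = b) ∨ (e 0 = b ∧ e 1 = a)) ∧
      ∃ i1, 1 ≤ i1 ∧ i1 < #A ∧ ((e i1 = c ∧ e ((i1 + 1) % #A) = d) ∨ (e i1 = d ∧ e ((i1 + 1) % #A) = c)) := by
  have hne : A.Nonempty := ⟨a, ha⟩
  have hsub : ∀ l : List V, l.Nodup → (∀ x ∈ l, x ∈ A) → l.length ≤ #A := by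
    intro l hl hx
    rw [← List.toFinset_card_of_nodup hl]
    exact card_le_card fun x h => hx x (by simpa using h)
  by_cases h2 : #A = 2
  · obtain ⟨e, e1, e2, e3⟩ := enum_finset A hne [a, b] (by simp [hab]) (by simp [ha, hb])
    have g0 := e3 0 a (by simp)
    have g1 := e3 1 b (by simp)
    refine ⟨e, e1, e2, Or.inl ⟨g0, g1⟩, 1, le_rfl, by omega, ?_⟩
    have hA : A = {a, b} := by
      symm; apply eq_of_subset_of_card_le
      · intro x hx; simp at hx; rcases hx with rfl | rfl <;> assumption
      · rw [card_pair hab, h2]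
    rw [h2]
    simp only [Nat.reduceAdd, Nat.mod_self, g0, g1]
    rw [hA] at hc hd
    simp at hc hd
    rcases hc with rfl | rfl <;> rcases hd with rfl | rfl
    · exact absurd rfl hcd
    · right; exact ⟨rfl, rfl⟩
    · left; exact ⟨rfl, rfl⟩
    · exact absurd rfl hcd
  · obtain ⟨hca, hcb⟩ := h.resolve_left h2
    by_cases hdb : d = b
    · subst hdb
      have hn : [a, d, c].Nodup := by simp [hab, hca.symm, hcb.symm]
      have hi : ∀ x ∈ [a, d, c], x ∈ A := by simp [ha, hb, hc]
      have hs := hsub _ hn hi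
      simp only [List.length_cons, List.length_nil] at hs
      obtain ⟨e, e1, e2, e3⟩ := enum_finset A hne _ hn hi
      refine ⟨e, e1, e2, Or.inl ⟨e3 0 a (by simp), e3 1 d (by simp)⟩, 1, le_rfl, by omega, Or.inr ⟨e3 1 d (by simp), ?_⟩⟩
      rw [Nat.mod_eq_of_lt (by omega)]
      exact e3 2 c (by simp)
    by_cases hda : d = a
    · subst hda
      have hn : [b, d, c].Nodup := by simp [hab.symm, hca.symm, hcb.symm]
      have hi : ∀ x ∈ [b, d, c], x ∈ A := by simp [ha, hb, hc]
      have hs := hsub _ hn hi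
      simp only [List.length_cons, List.length_nil] at hs
      obtain ⟨e, e1, e2, e3⟩ := enum_finset A hne _ hn hi
      refine ⟨e, e1, e2, Or.inr ⟨e3 0 b (by simp), e3 1 d (by simp)⟩, 1, le_rfl, by omega, Or.inr ⟨e3 1 d (by simp), ?_⟩⟩
      rw [Nat.mod_eq_of_lt (by omega)]
      exact e3 2 c (by simp)
    · have hn : [a, b, c, d].Nodup := by
        simp [hab, hca.symm, hcb.symm, hcd, Ne.symm hdb, Ne.symm hda]
      have hi : ∀ x ∈ [a, b, c, d], x ∈ A := by simp [ha, hb, hc, hd]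
      have hs := hsub _ hn hi
      simp only [List.length_cons, List.length_nil] at hs
      obtain ⟨e, e1, e2, e3⟩ := enum_finset A hne _ hn hi
      refine ⟨e, e1, e2, Or.inl ⟨e3 0 a (by simp), e3 1 b (by simp)⟩, 2, by omega, by omega, Or.inl ⟨e3 2 c (by simp), ?_⟩⟩
      rw [Nat.mod_eq_of_lt (by omega)]
      exact e3 3 d (by simp)

/-- A good piece provides a long link starting at any attachment vertex. -/
lemma good_link {G : SimpleGraph V} {t : ℕ} {W A : Finset V} (hW : TwoC G W) {𝒟 : Finset (Finset V)} {B : ℕ}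
    (h : Pieces G W A 𝒟 B) (hAt : #A < t) {D : Finset V} (hD : D ∈ 𝒟)
    (hgood : 2 * t * #D ≤ IE G D D + 2 * IE G D A) {a : V} (ha : a ∈ A) :
    ∃ b ∈ A, a ≠ b ∧ Link G D a b (t - #A + 2) := by
  obtain ⟨hAW, hA2, hp, hdj⟩ := h
  obtain ⟨d1, d2, d3, d4, d5, d6, d7⟩ := hp D hD
  set X := D.filter (G.Adj a) with hX
  set Y := D.filter (fun u => ∃ b ∈ A.erase a, G.Adj b u) with hY
  have hXne : X.Nonempty := by
    obtain ⟨u, hu, hau⟩ := d7 a ha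
    exact ⟨u, mem_filter.2 ⟨hu, hau⟩⟩
  have hca : #(A.erase a) = #A - 1 := card_erase_of_mem ha
  have hYne : Y.Nonempty := by
    obtain ⟨b, hb⟩ : (A.erase a).Nonempty := card_pos.1 (by omega)
    obtain ⟨u, hu, hau⟩ := d7 b (mem_of_mem_erase hb)
    exact ⟨u, mem_filter.2 ⟨hu, b, hb, hau⟩⟩
  have hgad : Gad G D X Y := by
    intro v hv K hK hne hcl
    by_contra hno
    push Not at hno
    have hKD : ∀ z ∈ K, z ∈ D ∧ z ≠ v := fun z hz => by have := hK hz; simp at this; tauto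
    have := hW.conn_erase v K (fun z hz => mem_erase.2 ⟨(hKD z hz).2, d3 (hKD z hz).1⟩) hne (by
      intro u hu w hw ha'
      rw [mem_erase] at hw
      rcases d6 u (hKD u hu).1 w hw.2 ha' with h | h
      · exact (hcl u hu w h ha').resolve_right hw.1
      · exfalso
        apply hno u hu
        rw [mem_union]
        by_cases hwa : w = a
        · left; subst hwa; exact mem_filter.2 ⟨(hKD u hu).1, ha'.symm⟩
        · right; exact mem_filter.2 ⟨(hKD u hu).1, w, mem_erase.2 ⟨hwa, h⟩, ha'.symm⟩)
    have hav : a ≠ v := by rintro rfl; exact Finset.disjoint_left.1 d4 hv ha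
    have haK : a ∈ K := by rw [this]; exact mem_erase.2 ⟨hav, hAW ha⟩
    exact Finset.disjoint_left.1 d4 (hKD a haK).1 ha
  have hcount : 2 * (t - #A + 2) * #D ≤ IE G D D + 2 * #X + 2 * #Y := by
    have e1 : IE G D A = #X + IE G D (A.erase a) := by
      conv_lhs => rw [← insert_erase ha, insert_eq]
      rw [IE_union_right G (by simp), IE_singleton_right]
    have e2 : IE G D (A.erase a) ≤ #Y + (#A - 2) * #D := by
      rw [IE_eq, hY, card_filter]
      have : (#A - 2) * #D = ∑ u ∈ D, (#A - 2) := by simp [mul_comm]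
      rw [this, ← sum_add_distrib]
      refine sum_le_sum fun u hu => ?_
      split_ifs with h
      · have := card_filter_le (A.erase a) (G.Adj u)
        omega
      · have : (A.erase a).filter (G.Adj u) = ∅ := by
          rw [filter_eq_empty_iff]
          intro b hb hub
          exact h ⟨b, hb, hub.symm⟩
        rw [this]; simp
    have e3 : 2 * t * #D = 2 * (t - #A + 2) * #D + 2 * ((#A - 2) * #D) := by
      have : t = (t - #A + 2) + (#A - 2) := by omega
      conv_lhs => rw [this]
      ring
    omega
  obtain ⟨l, ⟨l1, l2, l3, l4, l5⟩, l6⟩ := gadget_path (τ := t - #A + 2) (by omega) _ G D X Y rfl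
    (filter_subset _ _) (filter_subset _ _) hXne hYne d2 hgad hcount
  have hlast := l5 _ (List.getLast?_eq_some_getLast l3)
  obtain ⟨_, b, hb, hbl⟩ := mem_filter.1 hlast
  refine ⟨b, mem_of_mem_erase hb, (mem_erase.1 hb).1.symm, l, l1, l3, l2, ?_, ?_, l6⟩
  · intro x hx; exact (mem_filter.1 (l4 x hx)).2
  · intro x hx
    rw [List.getLast?_eq_some_getLast l3] at hx
    simp at hx; subst hx
    exact hbl.symm

lemma good_absurd {G : SimpleGraph V} {t : ℕ} (hG : ¬ HasCycleGE G (2 * t + 1))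
    {W A : Finset V} (hW : TwoC G W) {𝒟 : Finset (Finset V)} {B : ℕ}
    (h : Pieces G W A 𝒟 B) (hAt : #A < t) (h𝒟 : t + 3 ≤ #𝒟)
    (hgood : ∀ D ∈ 𝒟, 2 * t * #D ≤ IE G D D + 2 * IE G D A) : False := by
  have hlink := fun D hD a ha => good_link hW h hAt (D := D) hD (hgood D hD) (a := a) ha
  obtain ⟨hAW, hA2, hp, hdj⟩ := h
  obtain ⟨D0, hD0, D1, hD1, hne⟩ := one_lt_card.1 (show 1 < #𝒟 by omega)
  obtain ⟨a, ha⟩ : A.Nonempty := card_pos.1 (by omega)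
  obtain ⟨b, hb, hab, hl0⟩ := hlink D0 hD0 a ha
  obtain ⟨c, hc, hcc⟩ : ∃ c ∈ A, #A = 2 ∨ (c ≠ a ∧ c ≠ b) := by
    by_cases h2 : #A = 2
    · exact ⟨a, ha, Or.inl h2⟩
    · obtain ⟨c, hc⟩ : ((A.erase a).erase b).Nonempty := by
        apply card_pos.1
        rw [card_erase_of_mem (mem_erase.2 ⟨hab.symm, hb⟩), card_erase_of_mem ha]; omega
      simp at hc
      exact ⟨c, hc.2.2, Or.inr ⟨hc.2.1, hc.1⟩⟩
  obtain ⟨d, hd, hcd, hl1⟩ := hlink D1 hD1 c hc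
  obtain ⟨e, e1, e2, e3, i1, hi1, hi1s, e4⟩ := order_lemma ha hb hc hd hab hcd hcc
  have hrest : t + 1 ≤ #((𝒟.erase D0).erase D1) := by
    rw [card_erase_of_mem (mem_erase.2 ⟨hne.symm, hD1⟩), card_erase_of_mem hD0]; omega
  obtain ⟨E, E1, E2, -⟩ := enum_finset ((𝒟.erase D0).erase D1) (card_pos.1 (by omega)) [] (by simp) (by simp)
  have E1' : ∀ i < #A, E i ∈ 𝒟 ∧ E i ≠ D0 ∧ E i ≠ D1 := fun i hi => by
    have := E1 i (by omega)
    simp at this; tauto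
  let D : ℕ → Finset V := fun i => if i = 0 then D0 else if i = i1 then D1 else E i
  let n : ℕ → ℕ := fun i => 1 + ((if i = 0 then t - #A + 1 else 0) + (if i = i1 then t - #A + 1 else 0))
  have hDmem : ∀ i < #A, D i ∈ 𝒟 := by
    intro i hi
    simp only [D]
    split_ifs
    exacts [hD0, hD1, (E1' i hi).1]
  have hDinj : ∀ i < #A, ∀ j < #A, i ≠ j → D i ≠ D j := by
    intro i hi j hj hij
    simp only [D]
    split_ifs with h1 h2 h3 h4 h5 h6 h7
    · omega
    · exact hne
    · exact (E1' j hj).2.1.symm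
    · exact hne.symm
    · omega
    · exact (E1' j hj).2.2.symm
    · exact (E1' i hi).2.1
    · exact (E1' i hi).2.2
    · exact fun h => hij (E2 i (by omega) j (by omega) h)
  have key := necklace (G := G) (s := #A) hA2 e D n e2
    (fun i hi j hj hij => hdj _ (hDmem i hi) _ (hDmem j hj) (hDinj i hi j hj hij))
    (fun i hi j hj h => Finset.disjoint_left.1 (hp _ (hDmem j hj)).2.2.2.1 h (e1 i hi))
    (fun i hi => by
      have hm : (i + 1) % #A < #A := Nat.mod_lt _ (by omega)
      simp only [D, n]
      by_cases h0 : i = 0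
      · subst h0
        have h01 : ¬ (0 = i1) := by omega
        simp only [if_true, if_neg h01]
        rw [zero_add, Nat.mod_eq_of_lt (by omega)]
        have : 1 + (t - #A + 1 + 0) = t - #A + 2 := by omega
        rw [this]
        rcases e3 with ⟨h1, h2⟩ | ⟨h1, h2⟩
        · rw [h1, h2]; exact hl0
        · rw [h1, h2]; exact hl0.symm
      by_cases h1 : i = i1
      · subst h1
        simp only [if_neg h0, if_true]
        have : 1 + (0 + (t - #A + 1)) = t - #A + 2 := by omega
        rw [this]
        rcases e4 with ⟨h1, h2⟩ | ⟨h1, h2⟩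
        · rw [h1, h2]; exact hl1
        · rw [h1, h2]; exact hl1.symm
      · simp only [if_neg h0, if_neg h1]
        obtain ⟨_, hc, _, _, _, _, hat⟩ := hp _ (E1' i hi).1
        obtain ⟨u, hu, hau⟩ := hat _ (e1 i hi)
        obtain ⟨v, hv, hbv⟩ := hat _ (e1 _ hm)
        exact link_one hc hu hv hau hbv)
  apply hG
  obtain ⟨v, w, hw, hlen⟩ := key
  refine ⟨v, w, hw, le_trans ?_ hlen⟩
  simp only [n, sum_add_distrib, sum_ite_eq', mem_range, hi1s, if_true, show 0 < #A by omega]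
  simp
  omega

lemma twoC_sdiff {G : SimpleGraph V} {W A : Finset V} (hW : TwoC G W) {𝒟 : Finset (Finset V)} {B : ℕ}
    (h : Pieces G W A 𝒟 B) (h𝒟 : 3 ≤ #𝒟) {D : Finset V} (hD : D ∈ 𝒟) : TwoC G (W \ D) := by
  obtain ⟨hAW, hA2, hp, hdj⟩ := h
  obtain ⟨d1, d2, d3, d4, d5, d6, d7⟩ := hp D hD
  obtain ⟨D1, hD1, D2, hD2, hne⟩ := one_lt_card.1 (show 1 < #(𝒟.erase D) by
    rw [card_erase_of_mem hD]; omega)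
  rw [mem_erase] at hD1 hD2
  constructor
  · obtain ⟨f1, f2, f3, f4, f5, f6, f7⟩ := hp D1 hD1.2
    have hsub : A ∪ D1 ⊆ W \ D := by
      intro z hz
      rw [mem_union] at hz
      rw [mem_sdiff]
      rcases hz with h | h
      · exact ⟨hAW h, fun h' => Finset.disjoint_left.1 d4 h' h⟩
      · exact ⟨f3 h, Finset.disjoint_left.1 (hdj D1 hD1.2 D hD hD1.1) h⟩
    have := card_le_card hsub
    rw [card_union_of_disjoint f4.symm] at this
    have := card_pos.2 f1
    omega
  · intro X hX
    obtain ⟨E, hE, hED, hEX⟩ : ∃ E ∈ 𝒟, E ≠ D ∧ Disjoint E X := by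
      by_cases h1 : Disjoint D1 X
      · exact ⟨D1, hD1.2, hD1.1, h1⟩
      · refine ⟨D2, hD2.2, hD2.1, ?_⟩
        rw [Finset.not_disjoint_iff] at h1
        obtain ⟨z, hz, hzX⟩ := h1
        rw [Finset.disjoint_left]
        intro y hy hyX
        have : y = z := card_le_one.1 hX y hyX z hzX
        subst this
        exact Finset.disjoint_left.1 (hdj D1 hD1.2 D2 hD2.2 hne) hz hy
    obtain ⟨f1, f2, f3, f4, f5, f6, f7⟩ := hp E hE
    have hEdD : Disjoint E D := hdj E hE D hD hED
    have hEsub : ∀ z ∈ E, z ∈ (W \ D) \ X := fun z hz => by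
      simp only [mem_sdiff]
      exact ⟨⟨f3 hz, Finset.disjoint_left.1 hEdD hz⟩, Finset.disjoint_left.1 hEX hz⟩
    have hAsub : ∀ z ∈ A, z ∉ X → z ∈ (W \ D) \ X := fun z hz hzX => by
      simp only [mem_sdiff]
      exact ⟨⟨hAW hz, fun h' => Finset.disjoint_left.1 d4 h' hz⟩, hzX⟩
    intro K hK hKne hcl
    have hK' : ∀ z ∈ K, z ∈ W ∧ z ∉ D ∧ z ∉ X := fun z hz => by have := hK hz; simp at this; tauto
    by_cases hKE : (K ∩ E).Nonempty
    · have hEK : K ∩ E = E := f2 _ inter_subset_right hKE (by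
        intro u hu w hw ha
        rw [mem_inter] at hu ⊢
        exact ⟨hcl u hu.1 w (hEsub w hw) ha, hw⟩)
      have hEK' : ∀ z ∈ E, z ∈ K := fun z hz => by rw [← hEK] at hz; exact (mem_inter.1 hz).1
      have hAK : ∀ a ∈ A, a ∉ X → a ∈ K := by
        intro a ha haX
        obtain ⟨u, hu, hau⟩ := f7 a ha
        exact hcl u (hEK' u hu) a (hAsub a ha haX) hau.symm
      have := hW.2 X hX (K ∪ (D \ X)) (by
          intro z hz
          rw [mem_union, mem_sdiff] at hz
          rw [mem_sdiff]
          rcases hz with h | h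
          · exact ⟨(hK' z h).1, (hK' z h).2.2⟩
          · exact ⟨d3 h.1, h.2⟩) (hKne.mono subset_union_left) (by
        intro u hu w hw ha
        rw [mem_sdiff] at hw
        rw [mem_union, mem_sdiff] at hu ⊢
        by_cases hwD : w ∈ D
        · exact Or.inr ⟨hwD, hw.2⟩
        left
        rcases hu with hu | hu
        · exact hcl u hu w (by simp only [mem_sdiff]; exact ⟨⟨hw.1, hwD⟩, hw.2⟩) ha
        · exact hAK w ((d6 u hu.1 w hw.1 ha).resolve_left hwD) hw.2)
      apply hK.antisymm
      intro z hz
      simp only [mem_sdiff] at hz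
      have hz' : z ∈ K ∪ (D \ X) := by rw [this]; exact mem_sdiff.2 ⟨hz.1.1, hz.2⟩
      rw [mem_union, mem_sdiff] at hz'
      tauto
    · have hKE' : ∀ z ∈ E, z ∉ K := fun z hz hzK => hKE ⟨z, mem_inter.2 ⟨hzK, hz⟩⟩
      have hAK : ∀ a ∈ A, a ∉ K := by
        intro a ha haK
        obtain ⟨u, hu, hau⟩ := f7 a ha
        exact hKE' u hu (hcl a haK u (hEsub u hu) hau)
      have := hW.2 X hX K (fun z hz => mem_sdiff.2 ⟨(hK' z hz).1, (hK' z hz).2.2⟩) hKne (by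
        intro u hu w hw ha
        rw [mem_sdiff] at hw
        by_cases hwD : w ∈ D
        · rcases d6 w hwD u (hK' u hu).1 ha.symm with h | h
          · exact absurd h (hK' u hu).2.1
          · exact absurd hu (hAK u h)
        · exact hcl u hu w (by simp only [mem_sdiff]; exact ⟨⟨hw.1, hwD⟩, hw.2⟩) ha)
      obtain ⟨z, hz⟩ := f1
      exact absurd (by rw [this]; exact mem_sdiff.2 ⟨f3 hz, Finset.disjoint_left.1 hEX hz⟩) (hKE' z hz)

/-- The structure found in dense graphs. -/
def Core (G : SimpleGraph V) (A : Finset V) (𝒟 : Finset (Finset V)) : Prop :=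
  (∀ D ∈ 𝒟, D.Nonempty ∧ Conn G D ∧ Disjoint D A ∧ (∀ a ∈ A, ∃ u ∈ D, G.Adj a u)) ∧
    (∀ D ∈ 𝒟, ∀ D' ∈ 𝒟, D ≠ D' → Disjoint D D')

theorem dense_or_core (t M : ℕ) (ht : 2 ≤ t) : ∃ B K : ℕ, 1 ≤ B ∧ ∀ (V : Type) (G : SimpleGraph V),
    ¬ HasCycleGE G (2 * t + 1) → ∀ W : Finset V, TwoC G W →
    (B * IE G W W + #W ≤ 2 * B * t * #W + K) ∨ ∃ A 𝒟, #A = t ∧ M ≤ #𝒟 ∧ Core G A 𝒟 := by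
  set m0 := M + t + 4 with hm0
  set B := (m0 * 2 ^ (2 * t * (2 * t)) + 1) ^ (2 * t * (2 * t)) with hB
  have hB1 : 1 ≤ B := Nat.one_le_iff_ne_zero.2 (by positivity)
  refine ⟨B, B * (B * B) + B, hB1, ?_⟩
  intro V G hG W
  induction hn : #W using Nat.strong_induction_on generalizing W with
  | _ n ih =>
  intro hW
  by_cases hsmall : #W ≤ B
  · left
    have h1 : IE G W W ≤ B * B := (IE_le_mul G W W).trans (Nat.mul_le_mul hsmall hsmall)
    have h2 := Nat.mul_le_mul_left B h1
    omega
  obtain ⟨A, 𝒟, h𝒟, hP⟩ := exists_pieces (by omega) hG hW (m0 := m0) (by omega) (by omega)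
  rw [← hB] at hP
  have hAt := pieces_card_le (by omega) hG hP (by omega)
  by_cases hbad : ∃ D ∈ 𝒟, IE G D D + 2 * IE G D A < 2 * t * #D
  · obtain ⟨D, hD, hDbad⟩ := hbad
    have hW' := twoC_sdiff hW hP (by omega) hD
    obtain ⟨hAW, hA2, hp, hdj⟩ := hP
    obtain ⟨d1, d2, d3, d4, d5, d6, d7⟩ := hp D hD
    have hcard : #W = #D + #(W \ D) := by
      have := card_sdiff_add_card_eq_card d3; omega
    have hpos := card_pos.2 d1
    rcases ih (#(W \ D)) (by omega) (W \ D) rfl hW' with h | h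
    · left
      have hsplit : IE G W W = IE G D D + IE G (W \ D) (W \ D) + 2 * IE G D (W \ D) := by
        conv_lhs => rw [← union_sdiff_of_subset d3]
        exact IE_union_self G disjoint_sdiff
      have hDA : IE G D (W \ D) = IE G D A := by
        have hA' : A ⊆ W \ D := fun z hz => mem_sdiff.2 ⟨hAW hz, fun h' => Finset.disjoint_left.1 d4 h' hz⟩
        conv_lhs => rw [← union_sdiff_of_subset hA']
        rw [IE_union_right G disjoint_sdiff, IE_eq_zero G (X := D) (Y := (W \ D) \ A)]
        · rfl
        · intro u hu w hw ha
          simp only [mem_sdiff] at hw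
          rcases d6 u hu w hw.1.1 ha with h | h
          · exact hw.1.2 h
          · exact hw.2 h
      rw [← hn, hsplit, hDA, hcard]
      have h3 := Nat.mul_le_mul_left B (Nat.succ_le_of_lt hDbad)
      rw [Nat.succ_eq_add_one] at h3
      nlinarith
    · exact Or.inr h
  · push Not at hbad
    right
    have hAeq : #A = t := by
      by_contra hne
      exact good_absurd hG hW hP (by omega) (by omega) hbad
    refine ⟨A, 𝒟, hAeq, by omega, ?_, hP.2.2.2⟩
    intro D hD
    obtain ⟨d1, d2, d3, d4, d5, d6, d7⟩ := hP.2.2.1 D hD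
    exact ⟨d1, d2, d4, d7⟩

end Part6

section Part7
open Finset
open scoped Classical

variable {V : Type}

lemma conn_of_preconnected {G : SimpleGraph V} {S : Set V} {D : Finset V} (hS : ∀ x, x ∈ D ↔ x ∈ S)
    (h : (G.induce S).Preconnected) : Conn G D := by
  intro K hK hne hcl
  obtain ⟨x, hx⟩ := hne
  apply hK.antisymm
  intro y hy
  obtain ⟨p⟩ := h ⟨x, (hS x).1 (hK hx)⟩ ⟨y, (hS y).1 hy⟩
  have key : ∀ (a b : S) (p : (G.induce S).Walk a b), a.1 ∈ K → b.1 ∈ K := by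
    intro a b p
    induction p with
    | nil => exact id
    | cons hadj _ ih =>
      intro ha
      exact ih (hcl _ ha _ ((hS _).2 (Subtype.property _)) hadj)
  exact key _ _ p hx

lemma twoC_of_twoConnected [Fintype V] {G : SimpleGraph V} (h : TwoConnected G) : TwoC G univ := by
  obtain ⟨h1, h2, h3⟩ := h
  refine ⟨h1, ?_⟩
  intro X hX
  by_cases hX0 : X = ∅
  · subst hX0
    intro K _ hne hcl
    obtain ⟨x, hx⟩ := hne
    ext y
    simp only [sdiff_empty, mem_univ, iff_true]
    obtain ⟨p⟩ := h2.preconnected x y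
    have key : ∀ (a b : V) (p : G.Walk a b), a ∈ K → b ∈ K := by
      intro a b p
      induction p with
      | nil => exact id
      | cons hadj _ ih =>
        intro ha
        exact ih (hcl _ ha _ (by simp) hadj)
    exact key _ _ p hx
  · obtain ⟨v, rfl⟩ : ∃ v, X = {v} := by
      apply card_eq_one.1
      have := card_pos.2 (nonempty_iff_ne_empty.2 hX0)
      omega
    exact conn_of_preconnected (S := ({v}ᶜ : Set V)) (by simp) (h3 v).preconnected

lemma card_le_of_hits {𝒟 : Finset (Finset V)} (hdj : ∀ D ∈ 𝒟, ∀ D' ∈ 𝒟, D ≠ D' → Disjoint D D')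
    {S : Finset V} (h : ∀ D ∈ 𝒟, ∃ z ∈ D, z ∈ S) : #𝒟 ≤ #S := by
  by_cases hne : 𝒟 = ∅
  · subst hne; simp
  obtain ⟨D0, hD0⟩ := nonempty_iff_ne_empty.2 hne
  obtain ⟨z0, _⟩ := h D0 hD0
  haveI : Nonempty V := ⟨z0⟩
  choose! f hf1 hf2 using h
  apply card_le_card_of_injOn f (fun D hD => hf2 D hD)
  intro D hD D' hD' he
  by_contra hne
  have h1 := hf1 D hD
  have h2 := hf1 D' hD'
  rw [he] at h1
  exact Finset.disjoint_left.1 (hdj D hD D' hD' hne) h1 h2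

lemma two_attach [Fintype V] {G : SimpleGraph V} (hW : TwoC G univ) {A U : Finset V} (hA : 2 ≤ #A)
    (hUA : Disjoint U A) (hU2 : 2 ≤ #U) (hcl : ∀ u ∈ U, ∀ w, G.Adj u w → w ∈ U ∨ w ∈ A) :
    ∃ a ∈ A, ∃ b ∈ A, ∃ u ∈ U, ∃ v ∈ U, a ≠ b ∧ u ≠ v ∧ G.Adj a u ∧ G.Adj b v := by
  have hUne : U.Nonempty := card_pos.1 (by omega)
  obtain ⟨a0, ha0⟩ : A.Nonempty := card_pos.1 (by omega)
  obtain ⟨a1, ha1, u1, hu1, h1⟩ : ∃ a ∈ A, ∃ u ∈ U, G.Adj a u := by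
    by_contra hno
    push Not at hno
    have := hW.conn U (subset_univ _) hUne (by
      intro u hu w _ ha
      exact (hcl u hu w ha).resolve_right (fun h => hno w h u hu ha.symm))
    exact Finset.disjoint_left.1 hUA (by rw [this]; simp) ha0
  obtain ⟨a2, ha2, u2, hu2, h2⟩ : ∃ a ∈ A, ∃ u ∈ U.erase u1, G.Adj a u := by
    by_contra hno
    push Not at hno
    have := hW.conn_erase u1 (U.erase u1) (erase_subset_erase _ (subset_univ _))
      (card_pos.1 (by rw [card_erase_of_mem hu1]; omega)) (by
      intro u hu w hw ha
      refine mem_erase.2 ⟨(mem_erase.1 hw).1, ?_⟩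
      exact (hcl u (mem_of_mem_erase hu) w ha).resolve_right (fun h => hno w h u hu ha.symm))
    have ha0' : a0 ∈ U.erase u1 := by
      rw [this]; refine mem_erase.2 ⟨?_, mem_univ _⟩
      rintro rfl; exact Finset.disjoint_left.1 hUA hu1 ha0
    exact Finset.disjoint_left.1 hUA (mem_of_mem_erase ha0') ha0
  rw [mem_erase] at hu2
  by_cases h12 : a1 = a2
  · subst h12
    obtain ⟨b, hb, w, hw, h3⟩ : ∃ b ∈ A.erase a1, ∃ w ∈ U, G.Adj b w := by
      by_contra hno
      push Not at hno
      have := hW.conn_erase a1 U (fun z hz => mem_erase.2 ⟨by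
          rintro rfl; exact Finset.disjoint_left.1 hUA hz ha1, mem_univ _⟩) hUne (by
        intro u hu w hw ha
        exact (hcl u hu w ha).resolve_right (fun h => hno w (mem_erase.2 ⟨(mem_erase.1 hw).1, h⟩) u hu ha.symm))
      obtain ⟨b, hb⟩ : (A.erase a1).Nonempty := card_pos.1 (by rw [card_erase_of_mem ha1]; omega)
      rw [mem_erase] at hb
      have hbU : b ∈ U := by rw [this]; exact mem_erase.2 ⟨hb.1, mem_univ _⟩
      exact Finset.disjoint_left.1 hUA hbU hb.2
    rw [mem_erase] at hb
    by_cases hw1 : w = u1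
    · subst hw1
      exact ⟨a1, ha1, b, hb.2, u2, hu2.2, w, hw, hb.1.symm, hu2.1, h2, h3⟩
    · exact ⟨a1, ha1, b, hb.2, u1, hu1, w, hw, hb.1.symm, Ne.symm hw1, h1, h3⟩
  · exact ⟨a1, ha1, a2, ha2, u1, hu1, u2, hu2.2, h12, hu2.1.symm, h1, h2⟩

lemma core_indep [Fintype V] {G : SimpleGraph V} {t : ℕ} (ht : 2 ≤ t) (hG : ¬ HasCycleGE G (2 * t + 1))
    (hW : TwoC G univ) {A : Finset V} {𝒟 : Finset (Finset V)} (hA : #A = t) (hC : Core G A 𝒟)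
    (h𝒟 : 2 * t * (2 * t) + t ≤ #𝒟) {x y : V} (hx : x ∉ A) (hy : y ∉ A) : ¬ G.Adj x y := by
  intro hxy
  obtain ⟨hp, hdj⟩ := hC
  obtain ⟨U, hU, hxU⟩ := exists_comp (G := G) (U := univ \ A) (u := x) (by simp [hx])
  rw [mem_comps] at hU
  obtain ⟨hUA, hUne, hUc, hUcl⟩ := hU
  have hyU : y ∈ U := hUcl x hxU y (by simp [hy]) hxy
  obtain ⟨a, ha, b, hb, u, hu, v, hv, hab, huv, hau, hbv⟩ := two_attach hW (A := A) (U := U) (by omega)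
    (by rw [Finset.disjoint_left]; intro z hz; exact (mem_sdiff.1 (hUA hz)).2)
    (one_lt_card.2 ⟨x, hxU, y, hyU, hxy.ne⟩) (by
      intro u hu w ha
      by_cases hw : w ∈ A
      · exact Or.inr hw
      · exact Or.inl (hUcl u hu w (by simp [hw]) ha))
  obtain ⟨l, hl, hlU, hlh, hle⟩ := exists_path hUc hu hv
  have hlen := path_bound (by omega) hG hW hl (by simp)
  have hl2 : 2 ≤ l.length := by
    match l, hlh, hle with
    | [a], h1, h2 => simp at h1 h2; exact absurd (h1.symm.trans h2) huv
    | a :: b :: l, _, _ => simp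
  have hlink : Link G l.toFinset a b 2 := by
    refine ⟨l, hl, by rintro rfl; simp at hl2, by simp, ?_, ?_, hl2⟩
    · rw [hlh]; simpa using hau
    · rw [hle]; simpa using hbv.symm
  set DD := 𝒟.filter (fun D => Disjoint D l.toFinset) with hDD
  have hhit : #(𝒟.filter (fun D => ¬ Disjoint D l.toFinset)) ≤ #l.toFinset := by
    apply card_le_of_hits (fun D hD D' hD' => hdj D (mem_filter.1 hD).1 D' (mem_filter.1 hD').1)
    intro D hD
    have := (mem_filter.1 hD).2
    rw [Finset.not_disjoint_iff] at this
    exact this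
  have hsum := card_filter_add_card_filter_not (s := 𝒟) (fun D => Disjoint D l.toFinset)
  have hlt : #l.toFinset ≤ l.length := List.toFinset_card_le _
  rw [← hDD] at hsum
  have hDDc : t ≤ #DD := by omega
  obtain ⟨e, e1, e2, e3⟩ := enum_finset A ⟨a, ha⟩ [a, b] (by simp [hab]) (by simp [ha, hb])
  obtain ⟨E, E1, E2, -⟩ := enum_finset DD (card_pos.1 (by omega)) [] (by simp) (by simp)
  have E1' : ∀ i < t, E i ∈ 𝒟 ∧ Disjoint (E i) l.toFinset := fun i hi => mem_filter.1 (E1 i (by omega))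
  rw [hA] at e1 e2
  let D : ℕ → Finset V := fun i => if i = 0 then l.toFinset else E i
  have key := necklace (G := G) (s := t) ht e D (fun i => 1 + if i = 0 then 1 else 0) e2
    (by
      intro i hi j hj hij
      simp only [D]
      split_ifs with h1 h2 h2
      · omega
      · exact (E1' j hj).2.symm
      · exact (E1' i hi).2
      · exact hdj _ (E1' i hi).1 _ (E1' j hj).1 (fun h => hij (E2 i (by omega) j (by omega) h)))
    (by
      intro i hi j hj h
      simp only [D] at h
      split_ifs at h
      · have := hUA (hlU _ (List.mem_toFinset.1 h))
        exact (mem_sdiff.1 this).2 (e1 i hi)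
      · exact Finset.disjoint_left.1 (hp _ (E1' j hj).1).2.2.1 h (e1 i hi))
    (by
      intro i hi
      have hm : (i + 1) % t < t := Nat.mod_lt _ (by omega)
      simp only [D]
      by_cases h0 : i = 0
      · subst h0
        simp only [if_true, zero_add, Nat.mod_eq_of_lt (show 1 < t by omega)]
        rw [e3 0 a (by simp), e3 1 b (by simp)]
        exact hlink
      · simp only [if_neg h0]
        obtain ⟨_, hc, _, hat⟩ := hp _ (E1' i hi).1
        obtain ⟨u, hu, hau⟩ := hat _ (e1 i hi)
        obtain ⟨v, hv, hbv⟩ := hat _ (e1 _ hm)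
        exact link_one hc hu hv hau hbv)
  apply hG
  obtain ⟨v, w, hw, hlen⟩ := key
  refine ⟨v, w, hw, le_trans ?_ hlen⟩
  simp only [sum_add_distrib, sum_ite_eq', mem_range, if_true, show 0 < t by omega]
  simp
  omega

lemma two_edgeCount [Fintype V] (G : SimpleGraph V) : 2 * edgeCount G = IE G univ univ := by
  unfold edgeCount
  rw [← coe_edgeFinset, Set.ncard_coe_finset, ← sum_degrees_eq_twice_card_edges, IE_eq]
  refine sum_congr rfl fun x _ => ?_
  rw [← card_neighborFinset_eq_degree]
  congr 1; ext y; simp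

lemma IE_comap {β : Type} [Fintype β] (G : SimpleGraph V) (f : β → V) (hf : Function.Injective f) :
    IE (G.comap f) univ univ = IE G (univ.image f) (univ.image f) := by
  unfold IE
  rw [sum_image (fun a _ b _ h => hf h)]
  refine sum_congr rfl fun x _ => ?_
  rw [sum_image (fun a _ b _ h => hf h)]
  rfl

lemma exMax_bdd (n : ℕ) (P : SimpleGraph (Fin n) → Prop) :
    BddAbove {m | ∃ G : SimpleGraph (Fin n), P G ∧ edgeCount G = m} := by
  apply ((Set.finite_range (fun G : SimpleGraph (Fin n) => edgeCount G)).subset ?_).bddAbove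
  rintro m ⟨G, _, rfl⟩
  exact ⟨G, rfl⟩

lemma core_upper {α : Type*} [Fintype α] (F : SimpleGraph α) [Fintype V] {G : SimpleGraph V} {t : ℕ} (ht : 2 ≤ t)
    (hG : ¬ HasCycleGE G (2 * t + 1)) (hF : ¬ ContainsCopy F G)
    (hW : TwoC G univ) {A : Finset V} {𝒟 : Finset (Finset V)} (hA : #A = t) (hC : Core G A 𝒟)
    (h𝒟 : 2 * t * (2 * t) + t + Fintype.card α ≤ #𝒟) :
    edgeCount G ≤ exMax t (CoverFree F) + t * (Fintype.card V - t) := by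
  have hind : ∀ x y, x ∉ A → y ∉ A → ¬ G.Adj x y := fun x y hx hy =>
    core_indep ht hG hW hA hC (by omega) hx hy
  obtain ⟨hp, hdj⟩ := hC
  set Z := univ.filter (fun z => z ∉ A ∧ ∀ a ∈ A, G.Adj a z) with hZ
  have hZc : Fintype.card α ≤ #Z := by
    have : #𝒟 ≤ #Z := by
      apply card_le_of_hits hdj
      intro D hD
      obtain ⟨d1, d2, d3, d4⟩ := hp D hD
      obtain ⟨z, hz⟩ := d1
      have hDz : {z} = D := d2 {z} (by simpa using hz) (by simp) (by
        intro u hu w hw ha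
        simp at hu; subst hu
        exact absurd ha (hind _ _ (Finset.disjoint_left.1 d3 hz) (Finset.disjoint_left.1 d3 hw)))
      refine ⟨z, hz, ?_⟩
      rw [hZ, mem_filter]
      refine ⟨mem_univ _, Finset.disjoint_left.1 d3 hz, ?_⟩
      intro a ha
      obtain ⟨u, hu, hau⟩ := d4 a ha
      rw [← hDz] at hu; simp at hu; subst hu
      exact hau
    omega
  have heq : Fintype.card A = t := by rw [Fintype.card_coe]; exact hA
  let φ : Fin t ≃ A := (Fintype.equivFinOfCardEq heq).symm
  let f : Fin t → V := fun i => (φ i).1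
  have hf : Function.Injective f := fun i j h => φ.injective (Subtype.ext h)
  have himg : univ.image f = A := by
    ext z
    simp only [mem_image, mem_univ, true_and]
    constructor
    · rintro ⟨i, rfl⟩; exact (φ i).2
    · intro hz; exact ⟨φ.symm ⟨z, hz⟩, by simp [f]⟩
  have hfA : ∀ i, f i ∈ A := fun i => (φ i).2
  obtain ⟨ι⟩ : Nonempty (α ↪ Z) := Function.Embedding.nonempty_of_card_le (by rwa [Fintype.card_coe])
  have hιZ : ∀ a, (ι a).1 ∉ A ∧ ∀ b ∈ A, G.Adj b (ι a).1 := fun a => (mem_filter.1 (ι a).2).2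
  have hcov : CoverFree F (G.comap f) := by
    rintro S hS ⟨g, hg, hgadj⟩
    apply hF
    refine ⟨fun a => if h : a ∈ S then f (g ⟨a, h⟩) else (ι a).1, ?_, ?_⟩
    · intro a b hab
      simp only at hab
      split_ifs at hab with h1 h2 h2
      · simpa using hg (hf hab)
      · exact absurd (hab ▸ hfA _) (hιZ b).1
      · exact absurd (hab ▸ hfA _) (hιZ a).1
      · exact ι.injective (Subtype.ext hab)
    · intro a b hab
      simp only
      split_ifs with h1 h2 h2
      · exact hgadj (show (F.induce S).Adj ⟨a, h1⟩ ⟨b, h2⟩ from hab)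
      · exact (hιZ b).2 _ (hfA _)
      · exact ((hιZ a).2 _ (hfA _)).symm
      · exact absurd hab (hS a b h1 h2)
  have h1 : edgeCount (G.comap f) ≤ exMax t (CoverFree F) :=
    le_csSup (exMax_bdd t _) ⟨_, hcov, rfl⟩
  have h2 := two_edgeCount (G.comap f)
  rw [IE_comap G f hf, himg] at h2
  have h3 := two_edgeCount G
  have h4 : IE G univ univ = IE G A A + IE G Aᶜ Aᶜ + 2 * IE G A Aᶜ := by
    conv_lhs => rw [← union_compl A]
    exact IE_union_self G disjoint_compl_right
  have h5 : IE G Aᶜ Aᶜ = 0 := IE_eq_zero G fun x hx y hy => hind x y (by simpa using hx) (by simpa using hy)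
  have h6 := IE_le_mul G A Aᶜ
  rw [card_compl, hA] at h6
  omega

end Part7

section Part8
open Finset
open scoped Classical

lemma connected_of_pair {W : Type} {H : SimpleGraph W} (x y : W) (hxy : H.Adj x y)
    (h : ∀ w, w = x ∨ w = y ∨ H.Adj x w ∨ H.Adj y w) : H.Connected := by
  rw [connected_iff_exists_forall_reachable]
  refine ⟨x, fun w => ?_⟩
  rcases h w with rfl | rfl | h | h
  · exact Reachable.refl _
  · exact hxy.reachable
  · exact h.reachable
  · exact hxy.reachable.trans h.reachable

lemma bot_coverFree {α : Type*} [Fintype α] (F : SimpleGraph α) (t : ℕ) (hp : PGE F (t + 1)) :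
    CoverFree F (⊥ : SimpleGraph (Fin t)) := by
  rintro S hS ⟨f, hf, hadj⟩
  have h1 := (hp (fun a => decide (a ∈ S)) (by
    intro a b hab
    by_cases ha : a ∈ S <;> by_cases hb : b ∈ S
    · exact absurd (@hadj ⟨a, ha⟩ ⟨b, hb⟩ hab) (by simp)
    · simp [ha, hb]
    · simp [ha, hb]
    · exact absurd hab (hS a b ha hb))).1
  have h2 : Nat.card S ≤ t := by
    have := Nat.card_le_card_of_injective f hf
    simpa using this
  simp only [decide_eq_true_eq, Set.ofPred_mem_eq] at h1
  rw [← Nat.card_coe_set_eq] at h1 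
  omega

/-- The join of `T` with an independent set, on the vertex set `Fin n`. -/
def jn (t n : ℕ) (T : SimpleGraph (Fin t)) : SimpleGraph (Fin n) where
  Adj x y := (∃ (hx : x.1 < t) (hy : y.1 < t), T.Adj ⟨x.1, hx⟩ ⟨y.1, hy⟩) ∨
    (x.1 < t ∧ t ≤ y.1) ∨ (y.1 < t ∧ t ≤ x.1)
  symm := ⟨by
    rintro x y (⟨hx, hy, h⟩ | h | h)
    · exact Or.inl ⟨hy, hx, h.symm⟩
    · exact Or.inr (Or.inr h)
    · exact Or.inr (Or.inl h)⟩
  loopless := ⟨by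
    rintro x (⟨hx, hy, h⟩ | h | h)
    · exact h.ne rfl
    · omega
    · omega⟩

lemma jn_cross {t n : ℕ} {T : SimpleGraph (Fin t)} {x y : Fin n} (hx : x.1 < t) (hy : t ≤ y.1) :
    (jn t n T).Adj x y := Or.inr (Or.inl ⟨hx, hy⟩)

lemma jn_two {t n : ℕ} (T : SimpleGraph (Fin t)) (ht : 2 ≤ t) (hn : t + 2 ≤ n) :
    TwoConnected (jn t n T) := by
  refine ⟨by simp; omega, ?_, ?_⟩
  · apply connected_of_pair (⟨0, by omega⟩ : Fin n) ⟨t, by omega⟩ (jn_cross (by simp; omega) (by simp))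
    intro w
    by_cases hw : w.1 < t
    · exact Or.inr (Or.inr (Or.inr (jn_cross hw (by simp)).symm))
    · exact Or.inr (Or.inr (Or.inl (jn_cross (by simp; omega) (by omega))))
  · intro v
    obtain ⟨x, hx, hxv⟩ : ∃ x : Fin n, x.1 < t ∧ x ≠ v := by
      by_cases h : v.1 = 0
      · exact ⟨⟨1, by omega⟩, by simp; omega, by intro h'; rw [← h'] at h; simp at h⟩
      · exact ⟨⟨0, by omega⟩, by simp; omega, by intro h'; rw [← h'] at h; simp at h⟩
    obtain ⟨y, hy, hyv⟩ : ∃ y : Fin n, t ≤ y.1 ∧ y ≠ v := by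
      by_cases h : v.1 = t
      · exact ⟨⟨t + 1, by omega⟩, by simp, by intro h'; rw [← h'] at h; simp at h⟩
      · exact ⟨⟨t, by omega⟩, by simp, by intro h'; rw [← h'] at h; simp at h⟩
    apply connected_of_pair (⟨x, hxv⟩ : ({v}ᶜ : Set (Fin n))) ⟨y, hyv⟩ (jn_cross hx hy)
    intro w
    by_cases hw : w.1.1 < t
    · exact Or.inr (Or.inr (Or.inr (jn_cross hw hy).symm))
    · exact Or.inr (Or.inr (Or.inl (jn_cross hx (not_lt.1 hw))))

lemma jn_free {α : Type*} {t n : ℕ} (F : SimpleGraph α) (T : SimpleGraph (Fin t)) (hT : CoverFree F T) :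
    ¬ ContainsCopy F (jn t n T) := by
  rintro ⟨f, hf, hadj⟩
  refine hT {a | (f a).1 < t} ?_ ⟨fun a => ⟨(f a.1).1, a.2⟩, ?_, ?_⟩
  · intro a b ha hb hab
    simp only [Set.mem_ofPred_eq] at ha hb
    rcases hadj hab with ⟨h, _⟩ | h | h <;> omega
  · intro a b hab
    simp only [Fin.mk.injEq] at hab
    exact Subtype.ext (hf (Fin.ext hab))
  · intro a b hab
    have ha := a.2; have hb := b.2
    simp only [Set.mem_ofPred_eq] at ha hb
    rcases hadj hab with ⟨_, _, h⟩ | h | h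
    · exact h
    · exact absurd hb (not_lt.2 h.2)
    · exact absurd ha (not_lt.2 h.2)

lemma jn_cycle {t n : ℕ} (T : SimpleGraph (Fin t)) : ¬ HasCycleGE (jn t n T) (2 * t + 1) := by
  rintro ⟨v, w, hw, hl⟩
  set X := (range w.length).filter (fun i => (w.getVert i).1 < t) with hX
  set Y := (range w.length).filter (fun i => (w.getVert (i + 1)).1 < t) with hY
  have hc : range w.length ⊆ X ∪ Y := by
    intro i hi
    have hi' := mem_range.1 hi
    rw [mem_union, hX, hY, mem_filter, mem_filter]
    rcases w.adj_getVert_succ hi' with ⟨h, _⟩ | h | h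
    · exact Or.inl ⟨hi, h⟩
    · exact Or.inl ⟨hi, h.1⟩
    · exact Or.inr ⟨hi, h.1⟩
  have h1 : #X ≤ #(range t) := by
    apply card_le_card_of_injOn (fun i => (w.getVert i).1)
    · intro i hi
      have := (mem_filter.1 (mem_coe.1 hi)).2
      simpa using this
    · intro i hi j hj hij
      have hi := mem_range.1 (mem_filter.1 (mem_coe.1 hi)).1
      have hj := mem_range.1 (mem_filter.1 (mem_coe.1 hj)).1
      exact hw.getVert_injOn' (by simp; omega) (by simp; omega) (Fin.ext hij)
  have h2 : #Y ≤ #(range t) := by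
    apply card_le_card_of_injOn (fun i => (w.getVert (i + 1)).1)
    · intro i hi
      have := (mem_filter.1 (mem_coe.1 hi)).2
      simpa using this
    · intro i hi j hj hij
      have hi := mem_range.1 (mem_filter.1 (mem_coe.1 hi)).1
      have hj := mem_range.1 (mem_filter.1 (mem_coe.1 hj)).1
      have := hw.getVert_injOn (by simp; omega) (by simp; omega) (Fin.ext hij)
      omega
  have h3 := card_le_card hc
  have h4 := card_union_le X Y
  simp only [card_range] at *
  omega

lemma IE_split {W : Type} [Fintype W] (G : SimpleGraph W) (A B : Finset W)
    (hB : ∀ x, x ∈ B ↔ x ∉ A) :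
    IE G univ univ = IE G A A + IE G B B + 2 * IE G A B := by
  have h : Disjoint A B := by
    rw [Finset.disjoint_left]; intro x hx hx'; exact (hB x).1 hx' hx
  rw [← IE_union_self G h]
  have : A ∪ B = univ := by
    ext x; simp only [mem_union, hB, mem_univ, iff_true]; exact em _
  rw [this]

lemma jn_edges {t n : ℕ} (T : SimpleGraph (Fin t)) (hn : t ≤ n) :
    edgeCount (jn t n T) = edgeCount T + t * (n - t) := by
  have e1 := two_edgeCount (jn t n T)
  have e2 := two_edgeCount T
  have hcm : (jn t n T).comap (Fin.castLE hn) = T := by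
    ext x y
    have hx := x.2; have hy := y.2
    simp only [comap_adj]
    constructor
    · rintro (⟨_, _, h⟩ | h | h)
      · exact h
      · simp at h; omega
      · simp at h; omega
    · intro h
      exact Or.inl ⟨hx, hy, h⟩
  have e3 := IE_comap (jn t n T) (Fin.castLE hn) (Fin.castLE_injective hn)
  rw [hcm] at e3
  obtain ⟨A, hA⟩ : ∃ A, A = univ.image (Fin.castLE hn) := ⟨_, rfl⟩
  have e3 : IE T univ univ = IE (jn t n T) A A := by
    rw [e3, hA]; congr!
  have hmem : ∀ x : Fin n, x ∈ A ↔ x.1 < t := by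
    intro x
    rw [hA, mem_image]
    constructor
    · rintro ⟨y, _, rfl⟩; exact y.2
    · intro h; exact ⟨⟨x.1, h⟩, mem_univ _, rfl⟩
  have hAc : #A = t := by
    rw [hA, card_image_of_injective _ (Fin.castLE_injective hn)]; simp
  have hBc : #(univ \ A) = n - t := by
    rw [card_sdiff_of_subset (subset_univ _), hAc]; simp
  have e4 := IE_split (jn t n T) A (univ \ A) (by simp)
  have e5 : IE (jn t n T) (univ \ A) (univ \ A) = 0 := by
    apply IE_eq_zero
    intro x hx y hy h
    have hx := (mem_sdiff.1 hx).2
    have hy := (mem_sdiff.1 hy).2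
    rw [hmem] at hx hy
    rcases h with ⟨h, _⟩ | h | h <;> omega
  have e6 : IE (jn t n T) A (univ \ A) = t * (n - t) := by
    have hs : ∀ x ∈ A, #(filter ((jn t n T).Adj x) (univ \ A)) = n - t := ?_
    · rw [IE_eq, sum_congr rfl hs, sum_const, hAc, smul_eq_mul]
    intro x hx
    rw [← hBc]
    congr 1
    apply filter_true_of_mem
    intro y hy
    have hy := (mem_sdiff.1 hy).2
    rw [hmem] at hx hy
    exact jn_cross hx (by omega)
  rw [e5, e6] at e4
  omega

theorem main_aux {α : Type*} [Fintype α] (t : ℕ) (ht : 2 ≤ t)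
    (F : SimpleGraph α) (hpF : PGE F (t + 1)) :
    ∃ N : ℕ, ∀ n : ℕ, N ≤ n →
      exMax n (fun G => TwoConnected G ∧ ¬ HasCycleGE G (2 * t + 1) ∧ ¬ ContainsCopy F G)
        = exMax t (CoverFree F) + t * (n - t) := by
  obtain ⟨B, K, hB, hdc⟩ := dense_or_core t (2 * t * (2 * t) + t + Fintype.card α) ht
  refine ⟨K + 2 * B * t * t + t + 3, fun n hn => ?_⟩
  obtain ⟨T, hT, hTe⟩ : ∃ T : SimpleGraph (Fin t), CoverFree F T ∧ edgeCount T = exMax t (CoverFree F) :=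
    Nat.sSup_mem (s := {m | ∃ G : SimpleGraph (Fin t), CoverFree F G ∧ edgeCount G = m})
      ⟨_, ⊥, bot_coverFree F t hpF, rfl⟩ (exMax_bdd t (CoverFree F))
  have hmem : edgeCount T + t * (n - t) ∈ {m | ∃ G : SimpleGraph (Fin n),
      (TwoConnected G ∧ ¬ HasCycleGE G (2 * t + 1) ∧ ¬ ContainsCopy F G) ∧ edgeCount G = m} :=
    ⟨jn t n T, ⟨jn_two T ht (by omega), jn_cycle T, jn_free F T hT⟩, jn_edges T (by omega)⟩
  rw [← hTe]
  apply le_antisymm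
  · apply csSup_le ⟨_, hmem⟩
    rintro m ⟨G, ⟨h1, h2, h3⟩, rfl⟩
    have hW := twoC_of_twoConnected h1
    rcases hdc _ G h2 univ hW with h | ⟨A, 𝒟, hA, hM, hC⟩
    · rw [← two_edgeCount] at h
      simp only [card_univ, Fintype.card_fin] at h
      obtain ⟨r, rfl⟩ : ∃ r, n = r + t := ⟨n - t, by omega⟩
      rw [Nat.add_sub_cancel]
      suffices edgeCount G ≤ t * r by omega
      by_contra hlt
      push Not at hlt
      have : B * (2 * (t * r)) ≤ B * (2 * edgeCount G) := by gcongr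
      nlinarith
    · have := core_upper F ht h2 h3 hW hA hC hM
      rw [hTe]
      simpa using this
  · exact le_csSup (exMax_bdd n _) hmem

end Part8

theorem stmt0 {α : Type*} [Fintype α] (k : ℕ) (hk : 5 ≤ k) (hkodd : Odd k)
    (F : SimpleGraph α) (hpF : PGE F ((k - 1) / 2 + 1)) :
    ∃ N : ℕ, ∀ n : ℕ, N ≤ n →
      exMax n (fun G => TwoConnected G ∧ ¬ HasCycleGE G k ∧ ¬ ContainsCopy F G)
        = exMax ((k - 1) / 2) (CoverFree F)
          + ((k - 1) / 2) * (n - (k - 1) / 2) := by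
  obtain ⟨t, rfl⟩ := hkodd
  have e : (2 * t + 1 - 1) / 2 = t := by omega
  rw [e] at hpF ⊢
  exact main_aux t (by omega) F hpF
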